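/- Let O be a W-orbit in ℝ^r and t ∈ T_O. Set D_j := T_j^O for 1 ≤ j ≤ r and D_0 := (T_1^O T_2^O ⋯ T_{r−1}^O T_r^O T_{r−1}^O ⋯ T_1^O)^{−1} ∘ M, where M is the operator of multiplication by x^{−ε_1} on F[O]. Let J(O) := {j ∈ {0,…,r} : α_j(c^O) = 0}, let W_{J(O)} ⊆ W be the subgroup generated by {s_j : j ∈ J(O)}, and let W^O be the set of minimal-length representatives of the cosets W/W_{J(O)}. Then: (1) D_j(x^{c^O}) = k̃_j·x^{c^O} for every j ∈ J(O), where k̃_0 := u_r, k̃_i := k for 1 ≤ i < r, and k̃_r := k_r; (2) for every w ∈ W^O and every reduced expression w = s_{j_1}⋯s_{j_ℓ}, D_{j_1}(D_{j_2}(⋯(D_{j_ℓ}(x^{c^O}))⋯)) − k_w(c^O)·x^{wc^O} ∈ span_F{x^{y'} : y' < wc^O}, where k_w(c^O) := ∏_{m=1}^{ℓ} k_{s_{j_m}}(s_{j_{m+1}}⋯s_{j_ℓ}c^O) with k_{s_i}(z) := k^{−η(z_i−z_{i+1})} for 1 ≤ i < r, k_{s_r}(z) := k_r^{−η_e(2z_r)}·u_r^{−η_o(2z_r)},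 and k_{s_0}(z) := k_r^{−η_e(2z_1)}·u_r^{−η_o(2z_1)}·∏_{j=2}^r k^{−η(z_1−z_j)−η(z_1+z_j)} (each argument z = s_{j_{m+1}}⋯s_{j_ℓ}c^O satisfies α_{j_m}(z) > 0, so these formulas apply); in particular the value k_w(c^O) does not depend on the chosen reduced expression of w. -/

import Mathlib

open scoped Classical

noncomputable section

namespace QP

/-! ### The space of quasi-polynomials -/

/-- Euclidean space `ℝ^r`. -/
abbrev E (r : ℕ) := Fin r → ℝ

variable (F : Type*) [Field F] [CharZero F] (r : ℕ)

/-- The algebra of quasi-polynomials `F[ℝ^r]`: the group algebra of `(ℝ^r,+)` over `F`. -/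
abbrev QA := AddMonoidAlgebra F (E r)

/-- The quasi-monomial `x^y`. -/
def X (y : E r) : QA F r := AddMonoidAlgebra.single y 1

/-- The `i`-th coordinate of a vector (`1`-based). -/
def cd (y : E r) (i : ℕ) : ℝ := ∑ m : Fin r, if (m : ℕ) + 1 = i then y m else 0

/-- The standard basis vector `ε_i` (`1`-based). -/
def epsV (i : ℕ) : E r := fun m => if (m : ℕ) + 1 = i then 1 else 0

/-- The standard basis vector (`0`-based). -/
def eV (m : Fin r) : E r := fun n => if n = m then 1 else 0

/-- The Euclidean inner product on `ℝ^r`. -/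
def ip (v y : E r) : ℝ := ∑ m : Fin r, v m * y m

/-- An integral vector regarded as an element of `ℝ^r`. -/
def zc (lam : Fin r → ℤ) : E r := fun m => (lam m : ℝ)

/-- The simple reflections of the hyperoctahedral group `W₀ = S_r ⋉ (±1)^r` (`1`-based):
for `1 ≤ i < r`, `sW i` interchanges the `i`-th and `(i+1)`-st coordinates, and
`sW r` negates the last coordinate. -/
def sW (i : ℕ) (y : E r) : E r := fun m =>
  if i = r then (if (m : ℕ) + 1 = r then -y m else y m)
  else if (m : ℕ) + 1 = i then cd r y (i + 1)
  else if (m : ℕ) = i then cd r y i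
  else y m

/-- `s_{ε₁} = s₁⋯s_{r-1} s_r s_{r-1}⋯s₁`: negation of the first coordinate. -/
def sEps1 (y : E r) : E r := fun m => if (m : ℕ) = 0 then -y m else y m

/-- The affine simple reflection `s₀ = τ(ε₁) s_{ε₁} : y ↦ (1 - y₁, y₂, …, y_r)`, together
with `genF j = sW j` for `1 ≤ j ≤ r`: the Coxeter generators of the affine Weyl group
`W = W₀ ⋉ ℤ^r`. -/
def genF (j : ℕ) (y : E r) : E r :=
  if j = 0 then fun m => if (m : ℕ) = 0 then 1 - y m else y m
  else sW r j y

/-- The action of the word `s_{j₁} ⋯ s_{j_ℓ}` on `ℝ^r`. -/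
def wordAct (l : List ℕ) (y : E r) : E r := l.foldr (genF r) y

/-- The closure of the fundamental alcove
`C₊ = {y : 0 < y_r < ⋯ < y₁ < 1/2}`. -/
def CplusCl : Set (E r) :=
  {y | (∀ i j : Fin r, i ≤ j → y j ≤ y i) ∧ ∀ m : Fin r, 0 ≤ y m ∧ y m ≤ 1 / 2}

/-- The `W`-orbit of a point of `ℝ^r`. -/
def orbit (y : E r) : Set (E r) :=
  {z | ∃ l : List ℕ, (∀ a ∈ l, a ≤ r) ∧ wordAct r l y = z}

/-- `O` is a `W`-orbit in `ℝ^r`. -/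
def IsOrbit (O : Set (E r)) : Prop := ∃ y, O = orbit r y

/-- `c^𝒪`: the unique point of the orbit `O` lying in the closed fundamental alcove. -/
def cpt (O : Set (E r)) : E r :=
  if h : ∃ c, c ∈ O ∧ c ∈ CplusCl r then h.choose else 0

/-- The length of an element of the affine Weyl group `W` (as a map on `ℝ^r`). -/
def wlen (g : E r → E r) : ℕ :=
  sInf {n | ∃ l : List ℕ, (∀ a ∈ l, a ≤ r) ∧ l.length = n ∧ (fun y => wordAct r l y) = g}

/-- A choice of a shortest word `l` whose inverse maps `y` into the closed alcove;
the corresponding element of `W` is `g_y`. -/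
def gW (y : E r) : List ℕ :=
  if h : ∃ l : List ℕ, (∀ a ∈ l, a ≤ r) ∧ wordAct r l.reverse y ∈ CplusCl r ∧
      ∀ l' : List ℕ, (∀ a ∈ l', a ≤ r) → wordAct r l'.reverse y ∈ CplusCl r →
        l.length ≤ l'.length
  then h.choose else []

/-- `g_y`, the unique shortest element of `W` with `g_y⁻¹ y` in the closed alcove. -/
def gfun (y : E r) : E r → E r := fun z => wordAct r (gW r y) z

/-- The Bruhat order on `(W, {s₀,…,s_r})`, via the subword characterisation. -/
def bruhatLE (u v : E r → E r) : Prop :=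
  ∃ l : List ℕ, (∀ a ∈ l, a ≤ r) ∧ (fun z => wordAct r l z) = v ∧ l.length = wlen r v ∧
    ∃ l' : List ℕ, l'.Sublist l ∧ (fun z => wordAct r l' z) = u ∧ l'.length = wlen r u

/-- The partial order on `ℝ^r`: `y' ≤ y` iff `y'` and `y` lie in the same `W`-orbit and
`g_{y'} ≤_B g_y` in the Bruhat order. -/
def qle (y' y : E r) : Prop :=
  (∃ l : List ℕ, (∀ a ∈ l, a ≤ r) ∧ wordAct r l y = y') ∧ bruhatLE r (gfun r y') (gfun r y)

/-- Strict version of `qle`. -/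
def qlt (y' y : E r) : Prop := qle r y' y ∧ y' ≠ y

/-- The `F`-linear operator on `F[ℝ^r]` determined by its values on the quasi-monomials. -/
def mkOp (Ψ : E r → QA F r) : Module.End F (QA F r) :=
  Finsupp.linearCombination F Ψ ∘ₗ (AddMonoidAlgebra.coeffLinearEquiv F).toLinearMap

/-- `F[O] = span_F {x^y : y ∈ O}`. -/
def FO (O : Set (E r)) : Submodule F (QA F r) :=
  Submodule.span F {p | ∃ y ∈ O, p = X F r y}

/-- The Laurent polynomial subalgebra `F[ℤ^r] = span_F {x^μ : μ ∈ ℤ^r}`. -/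
def Lspan : Submodule F (QA F r) :=
  Submodule.span F {p | ∃ lam : Fin r → ℤ, p = X F r (zc r lam)}

/-- `span_F {x^{y'} : y' < y}`. -/
def ltSpan (y : E r) : Submodule F (QA F r) :=
  Submodule.span F {p | ∃ y', qlt r y' y ∧ p = X F r y'}

/-! ### Floors and indicator/sign functions -/

/-- the largest even integer `≤ z` -/
def floorE (z : ℝ) : ℤ := 2 * ⌊z / 2⌋
/-- the largest odd integer `≤ z` -/
def floorO (z : ℝ) : ℤ := 2 * ⌊(z + 1) / 2⌋ - 1
/-- indicator of `ℤ ⊆ ℝ` -/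
def chiZ (z : ℝ) : ℕ := if ∃ n : ℤ, z = n then 1 else 0
/-- indicator of the even integers -/
def chiE (z : ℝ) : ℕ := if ∃ n : ℤ, z = 2 * n then 1 else 0
/-- indicator of the odd integers -/
def chiO (z : ℝ) : ℕ := if ∃ n : ℤ, z = 2 * n + 1 then 1 else 0
/-- `η_e`: `1` on even integers `≥ 2`, `-1` on even integers `≤ 0`, `0` otherwise -/
def etaE (z : ℝ) : ℤ := if ∃ n : ℤ, z = 2 * n then (if 2 ≤ z then 1 else -1) else 0
/-- `η_o`: `1` on odd integers `≥ 1`, `-1` on odd integers `≤ -1`, `0` otherwise -/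
def etaO (z : ℝ) : ℤ := if ∃ n : ℤ, z = 2 * n + 1 then (if 1 ≤ z then 1 else -1) else 0
/-- `η = η_e + η_o` -/
def eta (z : ℝ) : ℤ := etaE z + etaO z

/-- `geomS c v m` is the truncated geometric series `(1 - (c·x^v)^m)/(1 - c·x^v)`,
a genuine element of `F[ℝ^r]`; it is the unique element with
`(1 - c·x^v) * geomS c v m = 1 - c^m·x^{m v}`. -/
def geomS (c : F) (v : E r) (m : ℤ) : QA F r :=
  if 0 ≤ m then ∑ t ∈ Finset.range m.toNat, c ^ (t : ℤ) • X F r ((t : ℝ) • v)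
  else -∑ t ∈ Finset.range (-m).toNat, c ^ (-(t : ℤ) - 1) • X F r ((-(t : ℝ) - 1) • v)

/-! ### Truncated divided difference operators and Demazure–Lusztig operators -/

/-- `∇_i(x^y) = ((1 - (x_{i+1}/x_i)^{⌊y_i - y_{i+1}⌋})/(1 - x_i/x_{i+1}))·x^y`. -/
def nablaIel (i : ℕ) (y : E r) : QA F r :=
  geomS F r 1 (epsV r i - epsV r (i + 1)) (-⌊cd r y i - cd r y (i + 1)⌋) * X F r y

/-- `∇_r^e(x^y) = ((1 - x_r^{-⌊2y_r⌋_e})/(1 - x_r^2))·x^y`. -/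
def nablaReEl (y : E r) : QA F r :=
  geomS F r 1 ((2 : ℝ) • epsV r r) (-floorE (2 * cd r y r) / 2) * X F r y

/-- `∇_r^o(x^y) = ((x_r - x_r^{-⌊2y_r⌋_o})/(1 - x_r^2))·x^y`. -/
def nablaRoEl (y : E r) : QA F r :=
  X F r (epsV r r) *
    geomS F r 1 ((2 : ℝ) • epsV r r) ((-floorO (2 * cd r y r) - 1) / 2) * X F r y

def nablaIop (i : ℕ) : Module.End F (QA F r) := mkOp F r (nablaIel F r i)
def nablaReOp : Module.End F (QA F r) := mkOp F r (nablaReEl F r)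
def nablaRoOp : Module.End F (QA F r) := mkOp F r (nablaRoEl F r)

/-- The value of the truncated Demazure–Lusztig operator `T_i` (`1 ≤ i ≤ r`) on `x^y`. -/
def Tel (k kr ur : F) (i : ℕ) (y : E r) : QA F r :=
  if i = r then
    (kr ^ chiE (2 * cd r y r) * ur ^ chiO (2 * cd r y r)) • X F r (sW r r y)
      + (kr - kr⁻¹) • nablaReEl F r y + (ur - ur⁻¹) • nablaRoEl F r y
  else
    k ^ chiZ (cd r y i - cd r y (i + 1)) • X F r (sW r i y)
      + (k - k⁻¹) • nablaIel F r i y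

/-- The truncated Demazure–Lusztig operators `T_1, …, T_r` on `F[ℝ^r]`. -/
def Top (k kr ur : F) (i : ℕ) : Module.End F (QA F r) := mkOp F r (Tel F r k kr ur i)

/-! ### The torus and the affine generator -/

/-- `t^{ε_i}`: the `i`-th coordinate (`1`-based) of an element of the torus `T = (Fˣ)^r`. -/
def tcU (t : Fin r → Fˣ) (i : ℕ) : Fˣ := ∏ m : Fin r, if (m : ℕ) + 1 = i then t m else 1

/-- `t^λ` for `λ ∈ ℤ^r`. -/
def upow (t : Fin r → Fˣ) (lam : Fin r → ℤ) : Fˣ := ∏ m : Fin r, t m ^ lam m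

/-- `t^v` for a vector `v` with integral entries (entries read off via the floor). -/
def upowR (t : Fin r → Fˣ) (v : E r) : Fˣ := ∏ m : Fin r, t m ^ ⌊v m⌋

/-- The `W`-action on the torus `T = (Fˣ)^r`: for `g = τ(λ)w₀ ∈ W` (so `g y = w₀ y + λ`),
`(g t)_m = q^{λ_m} · t^{w₀⁻¹ ε_m}`, where `W₀` permutes and inverts coordinates and
`τ(λ) t = q^λ t`, with `q = (q^{1/2})²`. -/
def torusAct (qh : Fˣ) (g : E r → E r) (t : Fin r → Fˣ) : Fin r → Fˣ := fun m =>
  (qh * qh) ^ ⌊g 0 m⌋ * ∏ j : Fin r, t j ^ ⌊(g (eV r j) - g 0) m⌋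

/-- The action on the torus of the linear part of `g` alone (the `W₀`-action). -/
def torusAct0 (g : E r → E r) (t : Fin r → Fˣ) : Fin r → Fˣ := fun m =>
  ∏ j : Fin r, t j ^ ⌊(g (eV r j) - g 0) m⌋

/-- The simple affine roots `α₀(y) = 1 - 2y₁`, `α_i(y) = y_i - y_{i+1}` (`1 ≤ i < r`),
`α_r(y) = 2 y_r` as affine-linear functionals. -/
def alphaF (j : ℕ) (y : E r) : ℝ :=
  if j = 0 then 1 - 2 * cd r y 1
  else if j = r then 2 * cd r y r
  else cd r y j - cd r y (j + 1)

/-- `t^{α_j^∨}` where `α₀^∨ = (-ε₁, 1/2)`, `α_i^∨ = (ε_i - ε_{i+1}, 0)`, `α_r^∨ = (ε_r, 0)`. -/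
def tpowCo (qh : Fˣ) (t : Fin r → Fˣ) (j : ℕ) : Fˣ :=
  if j = 0 then qh * (tcU F r t 1)⁻¹
  else if j = r then tcU F r t r
  else tcU F r t j * (tcU F r t (j + 1))⁻¹

/-- The affine subtorus `T_𝒪 = {t ∈ T : t^{α_j^∨} = 1 whenever α_j(c^𝒪) = 0}`. -/
def TOset (qh : Fˣ) (O : Set (E r)) : Set (Fin r → Fˣ) :=
  {t | ∀ j : ℕ, j ≤ r → alphaF r j (cpt r O) = 0 → tpowCo F r qh t j = 1}

/-- `∇₀^e(x^y) = ((1 - (q^{-1/2}x₁)^{⌊-2y₁⌋_e})/(1 - q x₁^{-2}))·x^y`. -/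
def nabla0eEl (qh : F) (y : E r) : QA F r :=
  geomS F r (qh * qh) ((-2 : ℝ) • epsV r 1) (-floorE (-2 * cd r y 1) / 2) * X F r y

/-- `∇₀^o(x^y) = ((q^{1/2}x₁^{-1} - (q^{-1/2}x₁)^{⌊-2y₁⌋_o})/(1 - q x₁^{-2}))·x^y`. -/
def nabla0oEl (qh : F) (y : E r) : QA F r :=
  (qh • X F r ((-1 : ℝ) • epsV r 1)) *
    geomS F r (qh * qh) ((-2 : ℝ) • epsV r 1) ((-floorO (-2 * cd r y 1) - 1) / 2) * X F r y

/-- The value of `T₀^𝒪` on `x^y`. -/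
def T0el (qh : Fˣ) (k0 u0 : F) (t : Fin r → Fˣ) (y : E r) : QA F r :=
  (k0 ^ chiE (2 * cd r y 1) * u0 ^ chiO (2 * cd r y 1) *
      ((tcU F r (torusAct F r qh (gfun r y) t) 1 : Fˣ) : F)) • X F r (sEps1 r y)
    + (k0 - k0⁻¹) • nabla0eEl F r qh y + (u0 - u0⁻¹) • nabla0oEl F r qh y

/-- The operator `T₀^𝒪` (as a globally defined operator; on `F[𝒪]` it is the operator of
the quasi-polynomial representation). -/
def T0op (qh : Fˣ) (k0 u0 : F) (t : Fin r → Fˣ) : Module.End F (QA F r) :=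
  mkOp F r (T0el F r qh k0 u0 t)

/-- The full family `T₀^𝒪, T₁, …, T_r`. -/
def Tfull (qh : Fˣ) (k0 u0 k kr ur : F) (t : Fin r → Fˣ) (j : ℕ) : Module.End F (QA F r) :=
  if j = 0 then T0op F r qh k0 u0 t else Top F r k kr ur j

/-- The Hecke parameter `k_j` (`k₀`, `k` or `k_r`). -/
def kpar (k0 k kr : F) (j : ℕ) : F := if j = 0 then k0 else if j = r then kr else k

/-- `(T_j^𝒪)⁻¹ = T_j^𝒪 - k_j + k_j⁻¹` (the inverse on `F[𝒪]`, by the Hecke relation). -/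
def TfullInv (qh : Fˣ) (k0 u0 k kr ur : F) (t : Fin r → Fˣ) (j : ℕ) : Module.End F (QA F r) :=
  Tfull F r qh k0 u0 k kr ur t j - (kpar F r k0 k kr j - (kpar F r k0 k kr j)⁻¹) • 1

/-- The word `0, 1, …, r-1, r, r-1, …, i` used in the definition of `Y_i^𝒪`. -/
def Ylist (i : ℕ) : List ℕ :=
  0 :: (((List.range (r - 1)).map (· + 1)) ++ [r] ++ ((List.range (r - i)).map fun m => r - 1 - m))

/-- The commuting operators
`Y_i^𝒪 = (T_{i-1}^𝒪)⁻¹⋯(T₁^𝒪)⁻¹ · T₀^𝒪 · T₁^𝒪⋯T_{r-1}^𝒪 · T_r^𝒪 · T_{r-1}^𝒪⋯T_i^𝒪`. -/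
def Yop (qh : Fˣ) (k0 u0 k kr ur : F) (t : Fin r → Fˣ) (i : ℕ) : Module.End F (QA F r) :=
  ((((List.range (i - 1)).map (· + 1)).reverse.map (TfullInv F r qh k0 u0 k kr ur t)).prod) *
    (((Ylist r i).map (Tfull F r qh k0 u0 k kr ur t)).prod)

/-! ### The base points `𝔰^𝒪`, `𝔰_y` and the spectrum -/

/-- `n_i^𝒪` (with `c = c^𝒪`), resp. `m_i(y)` (with `c = y`). -/
def nO (c : E r) (m : Fin r) : ℤ :=
  (∑ j : Fin r, if m < j then eta (c m - c j) + eta (c m + c j) else 0) +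
    ∑ j : Fin r, if j < m then eta (c j + c m) - eta (c j - c m) else 0

/-- The base point `𝔰^𝒪 ∈ T`. -/
def sOtor (k0 u0 k kr ur : Fˣ) (O : Set (E r)) : Fin r → Fˣ := fun m =>
  (k0 * kr) ^ (-(chiE (2 * cpt r O m) : ℤ)) * (u0 * ur) ^ (chiO (2 * cpt r O m) : ℤ) *
    k ^ nO r (cpt r O) m

/-- The eigenvalue `γ_i^𝒪(y) = ((g_y(𝔰^𝒪·t))_i)⁻¹`. -/
def gammaO (qh k0 u0 k kr ur : Fˣ) (O : Set (E r)) (t : Fin r → Fˣ) (i : ℕ) (y : E r) : Fˣ :=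
  (tcU F r (torusAct F r qh (gfun r y) fun m => sOtor F r k0 u0 k kr ur O m * t m) i)⁻¹

/-- `𝔰_y ∈ T`. -/
def sfrak (k0 u0 k kr ur : Fˣ) (y : E r) : Fin r → Fˣ := fun m =>
  (k0 * kr) ^ etaE (2 * y m) * (u0 * ur) ^ etaO (2 * y m) * k ^ nO r y m

/-! ### Finite Weyl group combinatorics, positive roots -/

/-- The set of positive roots of type `C_r`. -/
def PhiPlus : Set (E r) :=
  {v | (∃ a b : Fin r, a < b ∧ v = eV r a - eV r b) ∨
       (∃ a b : Fin r, a < b ∧ v = eV r a + eV r b) ∨ ∃ a : Fin r, v = (2 : ℝ) • eV r a}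

/-- The root system of type `C_r`. -/
def Phi0 : Set (E r) := PhiPlus r ∪ {v | -v ∈ PhiPlus r}

/-- The normalisation factor `κ_w^𝒪 = ∏_{α ∈ Π(w)} 𝐤_α^{χ_e(α(c))}·𝐤_{α/2}^{-χ_o(α(c))}`,
where `Π(w) = {α ∈ Φ₀⁺ : wα ∈ -Φ₀⁺}`, `𝐤_α = 𝐤_{α/2} = k` for short roots and
`𝐤_α = k_r`, `𝐤_{α/2} = u_r` for long roots. -/
def kappaW (k kr ur : Fˣ) (w : E r → E r) (c : E r) : Fˣ :=
  (∏ p : Fin r × Fin r,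
      if p.1 < p.2 ∧ -w (eV r p.1 - eV r p.2) ∈ PhiPlus r then
        k ^ ((chiE (ip r (eV r p.1 - eV r p.2) c) : ℤ) - (chiO (ip r (eV r p.1 - eV r p.2) c) : ℤ))
      else 1) *
  (∏ p : Fin r × Fin r,
      if p.1 < p.2 ∧ -w (eV r p.1 + eV r p.2) ∈ PhiPlus r then
        k ^ ((chiE (ip r (eV r p.1 + eV r p.2) c) : ℤ) - (chiO (ip r (eV r p.1 + eV r p.2) c) : ℤ))
      else 1) *
  ∏ a : Fin r,
      if -w ((2 : ℝ) • eV r a) ∈ PhiPlus r then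
        kr ^ (chiE (ip r ((2 : ℝ) • eV r a) c) : ℤ) * ur ^ (-(chiO (ip r ((2 : ℝ) • eV r a) c) : ℤ))
      else 1

/-- Iterated application `T_{i₁}(T_{i₂}(⋯(T_{i_ℓ}(f))⋯))`. -/
def applyT (k kr ur : F) (l : List ℕ) (f : QA F r) : QA F r :=
  l.foldr (fun i g => Top F r k kr ur i g) f

/-- The length function of the finite Weyl group `W₀`. -/
def w0len (g : E r → E r) : ℕ :=
  sInf {n | ∃ l : List ℕ, (∀ a ∈ l, 1 ≤ a ∧ a ≤ r) ∧ l.length = n ∧ (fun y => wordAct r l y) = g}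

/-- Membership in `W₀` (as maps on `ℝ^r`). -/
def IsW0fun (w : E r → E r) : Prop :=
  ∃ l : List ℕ, (∀ a ∈ l, 1 ≤ a ∧ a ≤ r) ∧ w = fun y => wordAct r l y

/-- Membership in the parabolic subgroup `W_{0,𝒪}` generated by the `s_i`, `1 ≤ i ≤ r`,
with `α_i(c^𝒪) = 0`. -/
def IsWOOfun (O : Set (E r)) (u : E r → E r) : Prop :=
  ∃ l : List ℕ, (∀ a ∈ l, 1 ≤ a ∧ a ≤ r ∧ alphaF r a (cpt r O) = 0) ∧
    u = fun y => wordAct r l y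

/-- `v ∈ W₀^𝒪`: `v ∈ W₀` of minimal length in its coset `v·W_{0,𝒪}`. -/
def MinRep (O : Set (E r)) (v : E r → E r) : Prop :=
  IsW0fun r v ∧ ∀ u, IsWOOfun r O u → w0len r v ≤ w0len r fun y => v (u y)

/-- Membership in the affine Weyl group `W` (as maps on `ℝ^r`). -/
def IsWfun (g : E r → E r) : Prop :=
  ∃ l : List ℕ, (∀ a ∈ l, a ≤ r) ∧ g = fun y => wordAct r l y

/-- Membership in the parabolic subgroup `W_{J(𝒪)}` generated by the `s_j`, `j ∈ J(𝒪)`. -/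
def IsWJfun (O : Set (E r)) (u : E r → E r) : Prop :=
  ∃ l : List ℕ, (∀ a ∈ l, a ≤ r ∧ alphaF r a (cpt r O) = 0) ∧ u = fun y => wordAct r l y

/-- The `W`-action on the Laurent polynomials `F[ℤ^r]` by `q`-dilations and reflections:
`w(x^μ) = x^{wμ}` for `w ∈ W₀`, `τ(λ)(x^μ) = q^{-⟨μ,λ⟩} x^μ` (globally defined via the
linear/translation parts of `g`). -/
def LWact (qh : Fˣ) (g : E r → E r) : Module.End F (QA F r) :=
  mkOp F r fun v => (((qh * qh) ^ (-⌊ip r (g v - g 0) (g 0)⌋) : Fˣ) : F) • X F r (g v - g 0)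

/-! ### roots `ᾱ_j`, torus reflections -/

/-- The finite simple roots `ᾱ₀ = -2ε₁`, `ᾱ_i = ε_i - ε_{i+1}`, `ᾱ_r = 2ε_r`
(as integral vectors). -/
def abarI (j : ℕ) : Fin r → ℤ := fun m =>
  if j = 0 then (if (m : ℕ) = 0 then -2 else 0)
  else if j = r then (if (m : ℕ) + 1 = r then 2 else 0)
  else if (m : ℕ) + 1 = j then 1
  else if (m : ℕ) = j then -1
  else 0

/-- The corresponding coroots `ᾱ₀^∨ = -ε₁`, `ᾱ_i^∨ = ε_i - ε_{i+1}`, `ᾱ_r^∨ = ε_r`. -/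
def abarV (j : ℕ) : Fin r → ℤ := fun m =>
  if j = 0 then (if (m : ℕ) = 0 then -1 else 0)
  else if j = r then (if (m : ℕ) + 1 = r then 1 else 0)
  else if (m : ℕ) + 1 = j then 1
  else if (m : ℕ) = j then -1
  else 0

/-- `ᾱ_j` as a real vector. -/
def abarR (j : ℕ) : E r := fun m => ((abarI r j m : ℤ) : ℝ)

/-- The constants `c₀ = u₀u_r`, `c_i = k²`, `c_r = k₀k_r`. -/
def cpar (k0 u0 k kr ur : Fˣ) (j : ℕ) : Fˣ :=
  if j = 0 then u0 * ur else if j = r then k0 * kr else k * k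

/-- The action of the reflection `s_{ᾱ_j} ∈ W₀` on the torus `T` (with `s_{ᾱ₀} = s_{ε₁}`). -/
def sTor (j : ℕ) (t : Fin r → Fˣ) : Fin r → Fˣ := fun m =>
  if j = 0 then (if (m : ℕ) = 0 then (t m)⁻¹ else t m)
  else if j = r then (if (m : ℕ) + 1 = r then (t m)⁻¹ else t m)
  else if (m : ℕ) + 1 = j then tcU F r t (j + 1)
  else if (m : ℕ) = j then tcU F r t j
  else t m

/-! ### The operators `G_t^𝒪(a)` for affine roots `a = (α, n)` -/

/-- The coroot `α^∨ = 2α/⟨α,α⟩`. -/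
def coroot (v : E r) : E r := ((2 : ℝ) / ip r v v) • v

/-- The scalar `q^{2n/⟨α,α⟩}` appearing in `x^{a^∨}` for `a = (α,n)`. -/
def qsc (qh : Fˣ) (v : E r) (n : ℤ) : Fˣ := if ip r v v = 4 then qh ^ n else (qh * qh) ^ n

/-- `𝐤_a`: `k` if `α` is short; `k_r` if `α` long, `n` even; `k₀` if `α` long, `n` odd. -/
def kaf (k0 k kr : Fˣ) (v : E r) (n : ℤ) : Fˣ :=
  if ip r v v = 4 then (if Even n then kr else k0) else k

/-- `𝐤_{a/2}`: `k` if `α` is short; `u_r` if `α` long, `n` even; `u₀` if `α` long, `n` odd. -/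
def khaf (u0 k ur : Fˣ) (v : E r) (n : ℤ) : Fˣ :=
  if ip r v v = 4 then (if Even n then ur else u0) else k

/-- The reflection `s_α(y) = y - α(y)·α^∨`. -/
def sRefl (v y : E r) : E r := y - ip r v y • coroot r v

/-- `s_{a,t}(x^y) = (g_y t)^{-n α^∨} · x^{s_α y}`. -/
def saTel (qh : Fˣ) (t : Fin r → Fˣ) (v : E r) (n : ℤ) (y : E r) : QA F r :=
  ((upowR F r (torusAct F r qh (gfun r y) t) (((-n : ℤ) : ℝ) • coroot r v) : Fˣ) : F) •
    X F r (sRefl r v y)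

/-- The twisted reflection operator `s_{a,t}`. -/
def SaOp (qh : Fˣ) (t : Fin r → Fˣ) (v : E r) (n : ℤ) : Module.End F (QA F r) :=
  mkOp F r (saTel F r qh t v n)

/-- The value `G_t^𝒪(a)(x^y)` for the affine root `a = (v, n)`. -/
def Gel (qh k0 u0 k kr ur : Fˣ) (t : Fin r → Fˣ) (v : E r) (n : ℤ) (y : E r) : QA F r :=
  (((kaf F r k0 k kr v n : Fˣ) : F) ^ chiE (ip r v y) *
      ((khaf F r u0 k ur v n : Fˣ) : F) ^ chiO (ip r v y)) • X F r y
    + ((((kaf F r k0 k kr v n : Fˣ) : F) - ((kaf F r k0 k kr v n : Fˣ) : F)⁻¹) •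
          geomS F r (((qsc F r qh v n)⁻¹ * (qsc F r qh v n)⁻¹ : Fˣ) : F)
            ((-2 : ℝ) • coroot r v) (-floorE (ip r v y) / 2)
        + (((khaf F r u0 k ur v n : Fˣ) : F) - ((khaf F r u0 k ur v n : Fˣ) : F)⁻¹) •
          ((((qsc F r qh v n)⁻¹ : Fˣ) : F) • X F r ((-1 : ℝ) • coroot r v) *
            geomS F r (((qsc F r qh v n)⁻¹ * (qsc F r qh v n)⁻¹ : Fˣ) : F)
              ((-2 : ℝ) • coroot r v) (-(floorO (ip r v y) + 1) / 2))) *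
      saTel F r qh t v n y

/-- The operator `G_t^𝒪(a)` for `a = (v, n)`. -/
def Gop (qh k0 u0 k kr ur : Fˣ) (t : Fin r → Fˣ) (v : E r) (n : ℤ) : Module.End F (QA F r) :=
  mkOp F r (Gel F r qh k0 u0 k kr ur t v n)

/-- The twisted action `g_t` of `g ∈ W` on `F[𝒪]`:
`g_t(x^y) = (g_{w₀ y} t)^{-λ} x^{w₀ y}` for `g = τ(λ) w₀`. -/
def Wtw (qh : Fˣ) (t : Fin r → Fˣ) (g : E r → E r) : Module.End F (QA F r) :=
  mkOp F r fun y =>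
    (((upowR F r (torusAct F r qh (gfun r (g y - g 0)) t) (g 0))⁻¹ : Fˣ) : F) •
      X F r (g y - g 0)

/-! ### The operators `D_j` -/

/-- The palindromic word `1, …, r-1, r, r-1, …, 1`. -/
def palin : List ℕ :=
  ((List.range (r - 1)).map (· + 1)) ++ [r] ++ ((List.range (r - 1)).map (· + 1)).reverse

/-- Multiplication by `x^{-ε₁}`. -/
def Mop : Module.End F (QA F r) := mkOp F r fun y => X F r ((-1 : ℝ) • epsV r 1) * X F r y

/-- `D₀ = (T₁^𝒪 ⋯ T_{r-1}^𝒪 T_r^𝒪 T_{r-1}^𝒪 ⋯ T₁^𝒪)⁻¹ ∘ M`. -/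
def D0op (qh : Fˣ) (k0 u0 k kr ur : F) (t : Fin r → Fˣ) : Module.End F (QA F r) :=
  ((palin r).map (TfullInv F r qh k0 u0 k kr ur t)).prod * Mop F r

/-- `D_j`: `D₀` for `j = 0` and `T_j^𝒪` for `1 ≤ j ≤ r`. -/
def Dop (qh : Fˣ) (k0 u0 k kr ur : F) (t : Fin r → Fˣ) (j : ℕ) : Module.End F (QA F r) :=
  if j = 0 then D0op F r qh k0 u0 k kr ur t else Tfull F r qh k0 u0 k kr ur t j

/-- Iterated application `D_{j₁}(D_{j₂}(⋯(D_{j_ℓ}(f))⋯))`. -/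
def applyD (qh : Fˣ) (k0 u0 k kr ur : F) (t : Fin r → Fˣ) (l : List ℕ) (f : QA F r) : QA F r :=
  l.foldr (fun j g => Dop F r qh k0 u0 k kr ur t j g) f

/-- The coefficients `k_{s_j}(y)`. -/
def ksj (k kr ur : Fˣ) (j : ℕ) (y : E r) : Fˣ :=
  if j = 0 then
    kr ^ (-etaE (2 * cd r y 1)) * ur ^ (-etaO (2 * cd r y 1)) *
      ∏ m : Fin r,
        (if 1 ≤ (m : ℕ) then k ^ (-eta (cd r y 1 - y m) - eta (cd r y 1 + y m)) else 1)
  else if j = r then kr ^ (-etaE (2 * cd r y r)) * ur ^ (-etaO (2 * cd r y r))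
  else k ^ (-eta (cd r y j - cd r y (j + 1)))

/-- `k_w(c) = ∏_m k_{s_{j_m}}(s_{j_{m+1}} ⋯ s_{j_ℓ} c)` for the word `w = s_{j₁} ⋯ s_{j_ℓ}`. -/
def kword (k kr ur : Fˣ) (l : List ℕ) (z : E r) : Fˣ :=
  (l.foldr (fun j p => (genF r j p.1, ksj F r k kr ur j p.1 * p.2)) (z, (1 : Fˣ))).2

set_option linter.unusedSimpArgs false

/-! ### Affine roots and signed affine permutations -/

/-- An affine root `s·y_i + t·y_j + n` of type `C_r` (long when `i = j`). -/
structure Rt (r : ℕ) where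
  i : Fin r
  j : Fin r
  s : ℤ
  t : ℤ
  n : ℤ
  hs : s = 1 ∨ s = -1
  ht : t = 1 ∨ t = -1
  hij : i = j → s = t

/-- Value of an affine root. -/
def Rt.ev {r : ℕ} (a : Rt r) (y : E r) : ℝ := a.s * y a.i + a.t * y a.j + a.n

/-- The coroot direction. -/
def Rt.co {r : ℕ} (a : Rt r) (m : Fin r) : ℝ := if m = a.i then a.s else if m = a.j then a.t else 0

/-- The reflection in an affine root. -/
def Rt.rf {r : ℕ} (a : Rt r) (y : E r) : E r := fun m => y m - a.ev y * a.co m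

/-- The opposite root. -/
def Rt.neg {r : ℕ} (a : Rt r) : Rt r where
  i := a.i
  j := a.j
  s := -a.s
  t := -a.t
  n := -a.n
  hs := by have := a.hs; omega
  ht := by have := a.ht; omega
  hij := fun h => by rw [a.hij h]

lemma Rt.ev_neg {r : ℕ} (a : Rt r) (y : E r) : a.neg.ev y = - a.ev y := by
  simp [Rt.ev, Rt.neg]; ring

lemma Rt.rf_neg {r : ℕ} (a : Rt r) (y : E r) : a.neg.rf y = a.rf y := by
  funext m
  have h : a.neg.co m = - a.co m := by
    simp only [Rt.co, Rt.neg]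
    by_cases h1 : m = a.i <;> by_cases h2 : m = a.j <;> simp [h1, h2]
    split_ifs <;> rfl
  simp only [Rt.rf, Rt.ev_neg, h]
  ring

/-- A signed affine permutation of the coordinates. -/
structure SP (r : ℕ) where
  p : Fin r → Fin r
  inj : Function.Injective p
  sg : Fin r → ℤ
  hsg : ∀ m, sg m = 1 ∨ sg m = -1
  off : Fin r → ℤ

/-- The action of a signed affine permutation. -/
def SP.act {r : ℕ} (g : SP r) (y : E r) : E r := fun m => g.sg m * y (g.p m) + g.off m

/-- The root `a ∘ g`. -/
def Rt.comp {r : ℕ} (a : Rt r) (g : SP r) : Rt r where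
  i := g.p a.i
  j := g.p a.j
  s := a.s * g.sg a.i
  t := a.t * g.sg a.j
  n := a.n + a.s * g.off a.i + a.t * g.off a.j
  hs := by rcases a.hs with h | h <;> rcases g.hsg a.i with h' | h' <;> simp [h, h']
  ht := by rcases a.ht with h | h <;> rcases g.hsg a.j with h' | h' <;> simp [h, h']
  hij := fun h => by have := g.inj h; rw [a.hij this, this]

lemma Rt.ev_comp {r : ℕ} (a : Rt r) (g : SP r) (y : E r) : (a.comp g).ev y = a.ev (g.act y) := by
  simp only [Rt.ev, Rt.comp, SP.act]; push_cast; ring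

lemma Rt.rf_act {r : ℕ} (a : Rt r) (g : SP r) (y : E r) :
    a.rf (g.act y) = g.act ((a.comp g).rf y) := by
  funext m
  simp only [Rt.rf, Rt.ev_comp]
  conv_rhs => rw [SP.act]
  simp only [Rt.rf, Rt.ev_comp]
  have h : a.co m = g.sg m * (a.comp g).co (g.p m) := by
    have h2 : (g.sg m : ℝ) * g.sg m = 1 := by
      rcases g.hsg m with h | h <;> simp [h]
    simp only [Rt.co, Rt.comp, g.inj.eq_iff]
    split_ifs with h1 h3
    · subst h1; push_cast; linear_combination (-(a.s : ℝ)) * h2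
    · subst h3; push_cast; linear_combination (-(a.t : ℝ)) * h2
    · simp
  rw [h]
  conv_lhs => rw [SP.act]
  ring

lemma cd_eq {r : ℕ} (y : E r) (m : Fin r) (i : ℕ) (h : i = m + 1) : cd r y i = y m := by
  subst h
  simp only [cd]
  rw [Finset.sum_eq_single m]
  · simp
  · intro b _ hb
    rw [if_neg]
    intro h; exact hb (Fin.ext (by omega))
  · simp

lemma genF_zero {r : ℕ} (y : E r) (m : Fin r) :
    genF r 0 y m = if (m : ℕ) = 0 then 1 - y m else y m := by
  simp [genF]

lemma genF_last {r : ℕ} (hr : 2 ≤ r) (y : E r) (m : Fin r) :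
    genF r r y m = if (m : ℕ) + 1 = r then - y m else y m := by
  have : r ≠ 0 := by omega
  simp [genF, sW, this]

lemma genF_mid {r : ℕ} {j : ℕ} (h0 : j ≠ 0) (h1 : j - 1 < r) (h2 : j < r) (y : E r) (m : Fin r) :
    genF r j y m = if (m : ℕ) + 1 = j then y ⟨j, h2⟩ else if (m : ℕ) = j then y ⟨j-1, h1⟩ else y m := by
  have hjr : j ≠ r := by omega
  simp only [genF, h0, if_false, sW, hjr]
  rw [cd_eq y ⟨j-1, h1⟩ j (by simp; omega), cd_eq y ⟨j, h2⟩ (j+1) (by simp)]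

lemma exSP {r : ℕ} (hr : 2 ≤ r) {j : ℕ} (hj : j ≤ r) : ∃ g : SP r, ∀ y, genF r j y = g.act y := by
  by_cases h0 : j = 0
  · subst h0
    refine ⟨⟨id, Function.injective_id, fun m => if (m : ℕ) = 0 then -1 else 1, ?_,
      fun m => if (m : ℕ) = 0 then 1 else 0⟩, ?_⟩
    · intro m; split_ifs <;> simp
    · intro y; funext m
      simp only [genF_zero, SP.act, id]
      split_ifs <;> push_cast <;> ring
  by_cases hjr : j = r
  · subst hjr
    refine ⟨⟨id, Function.injective_id, fun m => if (m : ℕ) + 1 = j then -1 else 1, ?_,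
      fun m => 0⟩, ?_⟩
    · intro m; split_ifs <;> simp
    · intro y; funext m
      simp only [genF_last hr, SP.act, id]
      split_ifs <;> push_cast <;> ring
  · have h1 : j - 1 < r := by omega
    have h2 : j < r := by omega
    refine ⟨⟨Equiv.swap ⟨j-1, h1⟩ ⟨j, h2⟩, Equiv.injective _, fun m => 1, fun m => Or.inl rfl,
      fun m => 0⟩, ?_⟩
    intro y; funext m
    simp only [genF_mid h0 h1 h2, SP.act]
    simp only [Equiv.swap_apply_def, Fin.ext_iff]
    split_ifs <;> first | omega | simp

lemma Rt.rf_zero {r : ℕ} (a : Rt r) (hi : (a.i : ℕ) = 0) (hj : (a.j : ℕ) = 0)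
    (hs : a.s = -1) (ht : a.t = -1) (hn : a.n = 1) (y : E r) : a.rf y = genF r 0 y := by
  funext m
  have hji : a.j = a.i := Fin.ext (by omega)
  simp only [genF_zero, Rt.rf, Rt.ev, Rt.co, hs, ht, hn, hji]
  by_cases h : m = a.i
  · subst h; simp [hi]; ring
  · rw [if_neg h, if_neg h, if_neg (fun h' => h (Fin.ext (by omega)))]; simp

lemma Rt.rf_last {r : ℕ} (hr : 2 ≤ r) (a : Rt r) (hi : (a.i : ℕ) + 1 = r) (hj : (a.j : ℕ) + 1 = r)
    (hs : a.s = 1) (ht : a.t = 1) (hn : a.n = 0) (y : E r) : a.rf y = genF r r y := by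
  funext m
  have hji : a.j = a.i := Fin.ext (by omega)
  simp only [genF_last hr, Rt.rf, Rt.ev, Rt.co, hs, ht, hn, hji]
  by_cases h : m = a.i
  · subst h; simp [hi]
  · rw [if_neg h, if_neg h, if_neg (fun h' => h (Fin.ext (by omega)))]; simp

lemma Rt.rf_mid {r : ℕ} {j : ℕ} (h0 : j ≠ 0) (h2 : j < r) (a : Rt r)
    (hi : (a.i : ℕ) + 1 = j) (hj : (a.j : ℕ) = j)
    (hs : a.s = 1) (ht : a.t = -1) (hn : a.n = 0) (y : E r) : a.rf y = genF r j y := by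
  funext m
  have h1 : j - 1 < r := by omega
  have hi' : a.i = ⟨j-1, h1⟩ := Fin.ext (by simp; omega)
  have hj' : a.j = ⟨j, h2⟩ := Fin.ext (by simp; omega)
  simp only [genF_mid h0 h1 h2, Rt.rf, Rt.ev, Rt.co, hs, ht, hn, hi', hj']
  by_cases hm : m = ⟨j-1, h1⟩
  · subst hm
    rw [if_pos rfl, if_pos (by simp; omega)]; push_cast; ring
  · by_cases hm' : m = ⟨j, h2⟩
    · subst hm'
      rw [if_neg hm, if_pos rfl, if_neg (by simp), if_pos rfl]; push_cast; ring
    · rw [if_neg hm, if_neg hm', if_neg, if_neg]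
      · simp
      · intro h; exact hm' (Fin.ext h)
      · intro h; exact hm (Fin.ext (by simp; omega))

lemma exRoot {r : ℕ} (hr : 2 ≤ r) {j : ℕ} (hj : j ≤ r) :
    ∃ a : Rt r, (∀ y, a.ev y = alphaF r j y) ∧ (∀ y, a.rf y = genF r j y) := by
  by_cases h0 : j = 0
  · subst h0
    refine ⟨⟨⟨0, by omega⟩, ⟨0, by omega⟩, -1, -1, 1, by simp, by simp, by simp⟩, ?_, ?_⟩
    · intro y
      simp only [Rt.ev, alphaF, if_true]
      rw [cd_eq y ⟨0, by omega⟩ 1 (by simp)]; push_cast; ring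
    · intro y; apply Rt.rf_zero <;> simp
  by_cases hjr : j = r
  · subst hjr
    refine ⟨⟨⟨j-1, by omega⟩, ⟨j-1, by omega⟩, 1, 1, 0, by simp, by simp, by simp⟩, ?_, ?_⟩
    · intro y
      simp only [Rt.ev, alphaF, h0, if_false, if_true]
      rw [cd_eq y ⟨j-1, by omega⟩ j (by simp; omega)]; push_cast; ring
    · intro y; apply Rt.rf_last hr <;> (try simp) <;> omega
  · have h1 : j - 1 < r := by omega
    have h2 : j < r := by omega
    refine ⟨⟨⟨j-1, h1⟩, ⟨j, h2⟩, 1, -1, 0, by simp, by simp, by simp; omega⟩, ?_, ?_⟩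
    · intro y
      simp only [Rt.ev, alphaF, h0, if_false, hjr]
      rw [cd_eq y ⟨j-1, h1⟩ j (by simp; omega), cd_eq y ⟨j, h2⟩ (j+1) (by simp)]; push_cast; ring
    · intro y; apply Rt.rf_mid h0 h2 <;> (try simp) <;> omega

/-! ### The generic point -/

/-- A generic point of the fundamental alcove. -/
def rho (r : ℕ) : E r := fun m => ((r : ℝ) - m) / (2 * (r + 1))

/-- The integral height of a root. -/
def Rt.ht' {r : ℕ} (a : Rt r) : ℤ := a.s * (r - a.i) + a.t * (r - a.j) + 2 * ((r + 1) * a.n)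

lemma Rt.ev_rho {r : ℕ} (a : Rt r) : a.ev (rho r) * (2 * (r + 1)) = a.ht' := by
  simp only [Rt.ev, rho, Rt.ht']
  have : (r : ℝ) + 1 ≠ 0 := by positivity
  field_simp
  push_cast
  ring

lemma Rt.ht'_cases {r : ℕ} (a : Rt r) :
    (a.n = 0 ∧ (r + 1) * a.n = 0) ∨ (a.n = 1 ∧ (r + 1) * a.n = r + 1) ∨
    (a.n = -1 ∧ (r + 1) * a.n = -(r + 1)) ∨ (2 ≤ a.n ∧ 2 * (r + 1) ≤ (r + 1) * a.n) ∨
    (a.n ≤ -2 ∧ (r + 1) * a.n ≤ -2 * (r + 1)) := by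
  have h : a.n = 0 ∨ a.n = 1 ∨ a.n = -1 ∨ 2 ≤ a.n ∨ a.n ≤ -2 := by omega
  rcases h with h | h | h | h | h
  · simp [h]
  · simp [h]
  · right; right; left; exact ⟨h, by rw [h]; ring⟩
  · right; right; right; left; exact ⟨h, by nlinarith⟩
  · right; right; right; right; exact ⟨h, by nlinarith⟩

lemma Rt.ht'_ne {r : ℕ} (a : Rt r) : a.ht' ≠ 0 := by
  have h1 := a.i.2
  have h2 := a.j.2
  have h3 : (a.i : ℕ) = a.j → a.s = a.t := fun h => a.hij (Fin.ext h)
  unfold Rt.ht'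
  have hn := a.ht'_cases
  generalize ((r : ℤ) + 1) * a.n = N at *
  rcases a.hs with hs | hs <;> rcases a.ht with ht | ht <;> simp only [hs, ht] at * <;> omega

lemma Rt.ev_rho_pos {r : ℕ} (a : Rt r) : 0 < a.ev (rho r) ↔ 0 < a.ht' := by
  have h := a.ev_rho
  have hp : (0 : ℝ) < 2 * (r + 1) := by positivity
  constructor
  · intro h'
    have : (0 : ℝ) < a.ht' := by rw [← h]; positivity
    exact_mod_cast this
  · intro h'
    have : (0 : ℝ) < a.ht' := by exact_mod_cast h'
    rw [← h] at this
    exact pos_of_mul_pos_left this hp.le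

lemma Rt.ev_rho_neg {r : ℕ} (a : Rt r) : a.ev (rho r) < 0 ↔ a.ht' < 0 := by
  have h := a.neg.ev_rho_pos
  rw [Rt.ev_neg] at h
  have : a.neg.ht' = - a.ht' := by simp [Rt.ht', Rt.neg]; ring
  rw [this] at h
  constructor
  · intro h'; have := h.1 (by linarith); omega
  · intro h'; have := h.2 (by omega); linarith

lemma Rt.ev_rho_ne {r : ℕ} (a : Rt r) : a.ev (rho r) ≠ 0 := by
  intro h
  have := a.ev_rho
  rw [h, zero_mul] at this
  exact a.ht'_ne (by exact_mod_cast this.symm)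

lemma Rt.nonneg_of_pos {r : ℕ} (a : Rt r) (h : 0 < a.ev (rho r)) {y : E r} (hy : y ∈ CplusCl r) :
    0 ≤ a.ev y := by
  rw [Rt.ev_rho_pos] at h
  have h1 := a.i.2
  have h2 := a.j.2
  have h3 : (a.i : ℕ) = a.j → a.s = a.t := fun h => a.hij (Fin.ext h)
  unfold Rt.ht' at h
  have hn := a.ht'_cases
  obtain ⟨hm, hb⟩ := hy
  have hi := hb a.i
  have hj := hb a.j
  unfold Rt.ev
  have key : (0 ≤ a.n ∧ ((a.s = 1 ∧ a.t = 1) ∨ (a.s = 1 ∧ a.t = -1 ∧ (a.i : ℕ) ≤ a.j) ∨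
      (a.s = -1 ∧ a.t = 1 ∧ (a.j : ℕ) ≤ a.i))) ∨ 1 ≤ a.n := by
    generalize ((r : ℤ) + 1) * a.n = N at *
    have h4 := a.hs
    have h5 := a.ht
    generalize a.s = s at *
    generalize a.t = t at *
    rcases h4 with rfl | rfl <;> rcases h5 with rfl | rfl <;> omega
  rcases key with ⟨hn, h⟩ | hn
  · have hn' : (0 : ℝ) ≤ a.n := by exact_mod_cast hn
    rcases h with ⟨hs, ht⟩ | ⟨hs, ht, hle⟩ | ⟨hs, ht, hle⟩
    · rw [hs, ht]; push_cast; linarith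
    · have := hm a.i a.j hle
      rw [hs, ht]; push_cast; linarith
    · have := hm a.j a.i hle
      rw [hs, ht]; push_cast; linarith
  · have hn' : (1 : ℝ) ≤ a.n := by exact_mod_cast hn
    rcases a.hs with hs | hs <;> rcases a.ht with ht | ht <;> rw [hs, ht] <;> push_cast <;> linarith

lemma Rt.nonpos_of_neg {r : ℕ} (a : Rt r) (h : a.ev (rho r) < 0) {y : E r} (hy : y ∈ CplusCl r) :
    a.ev y ≤ 0 := by
  have := a.neg.nonneg_of_pos (by rw [Rt.ev_neg]; linarith) hy
  rw [Rt.ev_neg] at this; linarith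

lemma Rt.rf_swap {r : ℕ} (a b : Rt r) (hi : a.i = b.j) (hj : a.j = b.i) (hs : a.s = b.t)
    (ht : a.t = b.s) (hn : a.n = b.n) (y : E r) : a.rf y = b.rf y := by
  have h := b.hij
  funext m
  simp only [Rt.rf, Rt.ev, Rt.co, hi, hj, hs, ht, hn]
  by_cases h1 : m = b.i <;> by_cases h2 : m = b.j <;> simp only [h1, h2, if_true, if_false]
  · have : b.i = b.j := by rw [← h1, ← h2]
    have hh := h this
    simp [hh, this]
  · rw [← h1]; simp [h2]; left; ring
  · rw [← h2]; simp [h1]; left; ring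
  · simp

/-- A positive root made negative by a simple reflection is the simple root. -/
lemma Rt.simple_of {r : ℕ} (hr : 2 ≤ r) {j : ℕ} (hj : j ≤ r) (a : Rt r)
    (h : 0 < a.ev (rho r)) (h' : a.ev (genF r j (rho r)) < 0) : ∀ y, a.rf y = genF r j y := by
  have hp : (0 : ℝ) < 2 * (r + 1) := by positivity
  rw [Rt.ev_rho_pos] at h
  have h1 := a.i.2
  have h2 := a.j.2
  have h3 : (a.i : ℕ) = a.j → a.s = a.t := fun h => a.hij (Fin.ext h)
  have hn := a.ht'_cases
  have hs := a.hs
  have ht := a.ht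
  unfold Rt.ht' at h
  have hgen : ∀ d : ℕ → ℤ, (∀ m : Fin r, genF r j (rho r) m * (2 * (r + 1)) = (r - m + d m : ℤ)) →
      a.s * (r - a.i + d a.i) + a.t * (r - a.j + d a.j) + 2 * ((r + 1) * a.n) < 0 := by
    intro d hd
    have : a.ev (genF r j (rho r)) * (2 * (r + 1)) =
        ((a.s * (r - a.i + d a.i) + a.t * (r - a.j + d a.j) + 2 * ((r + 1) * a.n) : ℤ) : ℝ) := by
      have e1 := hd a.i
      have e2 := hd a.j
      unfold Rt.ev
      push_cast at *
      linear_combination (a.s : ℝ) * e1 + (a.t : ℝ) * e2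
    have h5 : a.ev (genF r j (rho r)) * (2 * (r + 1)) < 0 := mul_neg_of_neg_of_pos h' hp
    rw [this] at h5
    exact_mod_cast h5
  have hr0 : (r : ℝ) + 1 ≠ 0 := by positivity
  by_cases h0 : j = 0
  · subst h0
    have := hgen (fun m => if m = 0 then 2 else 0) (by
      intro m
      rw [genF_zero]
      split_ifs with hm
      · simp only [rho, hm]; field_simp; push_cast; ring
      · simp only [rho]; field_simp; push_cast; ring)
    clear hgen h'
    have key : (a.i : ℕ) = 0 ∧ (a.j : ℕ) = 0 ∧ a.s = -1 ∧ a.t = -1 ∧ a.n = 1 := by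
      generalize ((r : ℤ) + 1) * a.n = N at *
      generalize a.s = s at *
      generalize a.t = t at *
      rcases hs with rfl | rfl <;> rcases ht with rfl | rfl <;> split_ifs at this <;> omega
    obtain ⟨k1, k2, k3, k4, k5⟩ := key
    exact fun y => Rt.rf_zero a k1 k2 k3 k4 k5 y
  by_cases hjr : j = r
  · subst hjr
    have := hgen (fun m => if m + 1 = j then -2 else 0) (by
      intro m
      rw [genF_last hr]
      split_ifs with hm
      · have hm' : (j : ℝ) = m + 1 := by exact_mod_cast hm.symm
        simp only [rho]; field_simp; push_cast; linarith
      · simp only [rho]; field_simp; push_cast; ring)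
    clear hgen h'
    have key : (a.i : ℕ) + 1 = j ∧ (a.j : ℕ) + 1 = j ∧ a.s = 1 ∧ a.t = 1 ∧ a.n = 0 := by
      generalize ((j : ℤ) + 1) * a.n = N at *
      generalize a.s = s at *
      generalize a.t = t at *
      rcases hs with rfl | rfl <;> rcases ht with rfl | rfl <;> split_ifs at this <;> omega
    obtain ⟨k1, k2, k3, k4, k5⟩ := key
    exact fun y => Rt.rf_last hr a k1 k2 k3 k4 k5 y
  · have hj1 : j - 1 < r := by omega
    have hj2 : j < r := by omega
    have := hgen (fun m => if m + 1 = j then -1 else if m = j then 1 else 0) (by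
      intro m
      rw [genF_mid h0 hj1 hj2]
      split_ifs with hm hm2
      · have hm' : (j : ℝ) = m + 1 := by exact_mod_cast hm.symm
        simp only [rho]; field_simp; push_cast; linarith
      · have hm' : ((j - 1 : ℕ) : ℝ) = m - 1 := by
          rw [Nat.cast_sub (by omega)]; rw [hm2]; simp
        simp only [rho]; field_simp; push_cast; linarith
      · simp only [rho]; field_simp; push_cast; ring)
    clear hgen h'
    have key : ((a.i : ℕ) + 1 = j ∧ (a.j : ℕ) = j ∧ a.s = 1 ∧ a.t = -1 ∧ a.n = 0) ∨
        ((a.j : ℕ) + 1 = j ∧ (a.i : ℕ) = j ∧ a.t = 1 ∧ a.s = -1 ∧ a.n = 0) := by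
      generalize ((r : ℤ) + 1) * a.n = N at *
      generalize a.s = s at *
      generalize a.t = t at *
      rcases hs with rfl | rfl <;> rcases ht with rfl | rfl <;> split_ifs at this <;> omega
    rcases key with ⟨k1, k2, k3, k4, k5⟩ | ⟨k1, k2, k3, k4, k5⟩
    · exact fun y => Rt.rf_mid h0 hj2 a k1 k2 k3 k4 k5 y
    · intro y
      rw [Rt.rf_swap a ⟨a.j, a.i, a.t, a.s, a.n, a.ht, a.hs, fun h => (a.hij h.symm).symm⟩
        rfl rfl rfl rfl rfl]
      exact Rt.rf_mid h0 hj2 ⟨a.j, a.i, a.t, a.s, a.n, a.ht, a.hs, fun h => (a.hij h.symm).symm⟩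
        k1 k2 k3 k4 k5 y

/-! ### Words -/

/-- A word in the Coxeter generators. -/
def OKw (r : ℕ) (l : List ℕ) : Prop := ∀ a ∈ l, a ≤ r

lemma OKw.tail {r j : ℕ} {l : List ℕ} (h : OKw r (j :: l)) : OKw r l :=
  fun a ha => h a (List.mem_cons_of_mem _ ha)

lemma OKw.head {r j : ℕ} {l : List ℕ} (h : OKw r (j :: l)) : j ≤ r := h j List.mem_cons_self

lemma OKw.cons {r j : ℕ} {l : List ℕ} (hj : j ≤ r) (h : OKw r l) : OKw r (j :: l) := by
  intro a ha
  rcases List.mem_cons.1 ha with rfl | ha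
  · exact hj
  · exact h a ha

lemma OKw.sub {r : ℕ} {l l' : List ℕ} (h : OKw r l) (hs : l'.Sublist l) : OKw r l' :=
  fun a ha => h a (hs.subset ha)

lemma OKw.rev {r : ℕ} {l : List ℕ} (h : OKw r l) : OKw r l.reverse :=
  fun a ha => h a (List.mem_reverse.1 ha)

lemma OKw.app {r : ℕ} {l l' : List ℕ} (h : OKw r l) (h' : OKw r l') : OKw r (l ++ l') := by
  intro a ha
  rcases List.mem_append.1 ha with ha | ha
  · exact h a ha
  · exact h' a ha

lemma Rt.ev_rf {r : ℕ} (a : Rt r) (y : E r) : a.ev (a.rf y) = - a.ev y := by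
  have h : (a.s : ℝ) * a.co a.i + a.t * a.co a.j = 2 := by
    simp only [Rt.co, if_true]
    by_cases h : a.j = a.i
    · rw [if_pos h]
      have := a.hij h.symm
      rcases a.hs with hs | hs <;> rw [← this, hs] <;> norm_num
    · rw [if_neg h]
      rcases a.hs with hs | hs <;> rcases a.ht with ht | ht <;> rw [hs, ht] <;> norm_num
  have h1 : a.ev (a.rf y) = a.ev y - a.ev y * ((a.s : ℝ) * a.co a.i + a.t * a.co a.j) := by
    simp only [Rt.rf, Rt.ev]; ring
  rw [h1, h]; ring

lemma Rt.rf_rf {r : ℕ} (a : Rt r) (y : E r) : a.rf (a.rf y) = y := by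
  funext m
  have : a.rf (a.rf y) m = a.rf y m - a.ev (a.rf y) * a.co m := rfl
  rw [this, Rt.ev_rf]
  simp [Rt.rf]

lemma Rt.rf_fix {r : ℕ} (a : Rt r) {y : E r} (h : a.ev y = 0) : a.rf y = y := by
  funext m
  simp [Rt.rf, h]

lemma genF_genF {r : ℕ} (hr : 2 ≤ r) {j : ℕ} (hj : j ≤ r) (y : E r) :
    genF r j (genF r j y) = y := by
  obtain ⟨a, -, h⟩ := exRoot hr hj
  rw [← h, ← h, Rt.rf_rf]

lemma alphaF_genF {r : ℕ} (hr : 2 ≤ r) {j : ℕ} (hj : j ≤ r) (y : E r) :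
    alphaF r j (genF r j y) = - alphaF r j y := by
  obtain ⟨a, h1, h⟩ := exRoot hr hj
  rw [← h, ← h1, Rt.ev_rf, h1]

lemma genF_fix {r : ℕ} (hr : 2 ≤ r) {j : ℕ} (hj : j ≤ r) {y : E r} (h0 : alphaF r j y = 0) :
    genF r j y = y := by
  obtain ⟨a, h1, h⟩ := exRoot hr hj
  rw [← h, Rt.rf_fix _ (by rw [h1, h0])]

lemma wordAct_nil {r : ℕ} (y : E r) : wordAct r [] y = y := rfl
lemma wordAct_cons {r : ℕ} (j : ℕ) (l : List ℕ) (y : E r) :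
    wordAct r (j :: l) y = genF r j (wordAct r l y) := rfl
lemma wordAct_append {r : ℕ} (l l' : List ℕ) (y : E r) :
    wordAct r (l ++ l') y = wordAct r l (wordAct r l' y) := by
  simp [wordAct, List.foldr_append]

lemma wordAct_rev {r : ℕ} (hr : 2 ≤ r) {l : List ℕ} (hl : OKw r l) (y : E r) :
    wordAct r l.reverse (wordAct r l y) = y := by
  induction l generalizing y with
  | nil => rfl
  | cons j l ih =>
    rw [List.reverse_cons, wordAct_append, wordAct_cons, wordAct_cons, wordAct_nil,
      genF_genF hr hl.head, ih hl.tail]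

lemma wordAct_rev' {r : ℕ} (hr : 2 ≤ r) {l : List ℕ} (hl : OKw r l) (y : E r) :
    wordAct r l (wordAct r l.reverse y) = y := by
  have := wordAct_rev hr hl.rev y
  rwa [List.reverse_reverse] at this

lemma word_root {r : ℕ} (hr : 2 ≤ r) {l : List ℕ} (hl : OKw r l) (a : Rt r) :
    ∃ b : Rt r, (∀ y, b.ev y = a.ev (wordAct r l y)) ∧
      ∀ y, a.rf (wordAct r l y) = wordAct r l (b.rf y) := by
  induction l generalizing a with
  | nil => exact ⟨a, fun _ => rfl, fun _ => rfl⟩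
  | cons j l ih =>
    obtain ⟨g, hg⟩ := exSP hr hl.head
    obtain ⟨b, h1, h2⟩ := ih hl.tail (a.comp g)
    refine ⟨b, fun y => ?_, fun y => ?_⟩
    · rw [h1, Rt.ev_comp, wordAct_cons, hg]
    · rw [wordAct_cons, hg, Rt.rf_act, h2, wordAct_cons, hg]

lemma pos_or_neg {r : ℕ} (a : Rt r) : 0 < a.ev (rho r) ∨ a.ev (rho r) < 0 := by
  rcases lt_trichotomy (a.ev (rho r)) 0 with h | h | h
  · exact Or.inr h
  · exact absurd h a.ev_rho_ne
  · exact Or.inl h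

lemma neg_at_rho {r : ℕ} (hr : 2 ≤ r) {c : E r} (hc : c ∈ CplusCl r) {l : List ℕ} (hl : OKw r l)
    (a : Rt r) (h : a.ev (wordAct r l c) < 0) : a.ev (wordAct r l (rho r)) < 0 := by
  obtain ⟨b, h1, -⟩ := word_root hr hl a
  rw [← h1] at h ⊢
  rcases pos_or_neg b with hb | hb
  · exact absurd (b.nonneg_of_pos hb hc) (not_le.2 h)
  · exact hb

lemma rho_mem (r : ℕ) : rho r ∈ CplusCl r := by
  refine ⟨fun i j h => ?_, fun m => ⟨?_, ?_⟩⟩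
  · have : (i : ℝ) ≤ j := by exact_mod_cast h
    simp only [rho]; gcongr
  · have : (m : ℝ) ≤ r := by exact_mod_cast m.2.le
    simp only [rho]
    apply div_nonneg <;> [linarith; positivity]
  · simp only [rho]
    rw [div_le_div_iff₀ (by positivity) (by norm_num)]
    have : (0 : ℝ) ≤ m := by positivity
    linarith

lemma mem_of_alpha {r : ℕ} (hr : 2 ≤ r) {y : E r} (h : ∀ j, j ≤ r → 0 ≤ alphaF r j y) :
    y ∈ CplusCl r := by
  have step : ∀ n (h1 : n < r) (h2 : n + 1 < r), y ⟨n+1, h2⟩ ≤ y ⟨n, h1⟩ := by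
    intro n h1 h2
    have := h (n+1) (by omega)
    rw [alphaF, if_neg (by omega), if_neg (by omega), cd_eq y ⟨n, h1⟩ _ rfl,
      cd_eq y ⟨n+1, h2⟩ _ rfl] at this
    linarith
  have mono : ∀ d n (h1 : n < r) (h2 : n + d < r), y ⟨n+d, h2⟩ ≤ y ⟨n, h1⟩ := by
    intro d
    induction d with
    | zero => intro n h1 h2; exact le_rfl
    | succ d ih => intro n h1 h2; exact (step (n+d) (by omega) h2).trans (ih n h1 (by omega))
  have anti : ∀ i j : Fin r, i ≤ j → y j ≤ y i := by
    intro i j hij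
    have hij' : (i : ℕ) ≤ j := hij
    have := mono (j - i) i i.2 (by omega)
    convert this using 2
    exact Fin.ext (by simp; omega)
  have e0 := h 0 (by omega)
  have e1 := h r le_rfl
  rw [alphaF, if_pos rfl, cd_eq y ⟨0, by omega⟩ 1 rfl] at e0
  rw [alphaF, if_neg (by omega), if_pos rfl, cd_eq y ⟨r-1, by omega⟩ r (by simp; omega)] at e1
  refine ⟨anti, fun m => ⟨?_, ?_⟩⟩
  · have := anti m ⟨r-1, by omega⟩ (by rw [Fin.le_def]; have := m.2; simp; omega)
    linarith
  · have := anti ⟨0, by omega⟩ m (by rw [Fin.le_def]; simp)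
    linarith

lemma deletion {r : ℕ} (hr : 2 ≤ r) {v : List ℕ} (hv : OKw r v) (a : Rt r)
    (h : 0 < a.ev (rho r)) (h' : a.ev (wordAct r v (rho r)) < 0) :
    ∃ w : List ℕ, w.Sublist v ∧ w.length + 1 = v.length ∧
      ∀ y, a.rf (wordAct r v y) = wordAct r w y := by
  induction v generalizing a with
  | nil => rw [wordAct_nil] at h'; exact absurd h (not_lt.2 h'.le)
  | cons j v ih =>
    obtain ⟨g, hg⟩ := exSP hr hv.head
    rcases pos_or_neg (a.comp g) with hp | hp
    · obtain ⟨w, h1, h2, h3⟩ := ih hv.tail (a.comp g) hp (by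
        rwa [Rt.ev_comp, ← hg])
      refine ⟨j :: w, h1.cons_cons j, by simp [h2], fun y => ?_⟩
      rw [wordAct_cons, hg, Rt.rf_act, h3, wordAct_cons, hg]
    · rw [Rt.ev_comp, ← hg] at hp
      refine ⟨v, List.sublist_cons_self _ _, by simp, fun y => ?_⟩
      rw [a.simple_of hr hv.head h hp, wordAct_cons, genF_genF hr hv.head]

lemma exRootPos {r : ℕ} (hr : 2 ≤ r) {j : ℕ} (hj : j ≤ r) :
    ∃ a : Rt r, 0 < a.ev (rho r) ∧ (∀ y, a.ev y = alphaF r j y) ∧ (∀ y, a.rf y = genF r j y) := by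
  obtain ⟨a, h1, h2⟩ := exRoot hr hj
  refine ⟨a, ?_, h1, h2⟩
  rcases pos_or_neg a with h | h
  · exact h
  exfalso
  rw [h1] at h
  have hp : (0 : ℝ) < 2 * (r + 1) := by positivity
  have hrr : (r : ℝ) + 1 ≠ 0 := by positivity
  by_cases h0 : j = 0
  · subst h0
    rw [alphaF, if_pos rfl, cd_eq _ ⟨0, by omega⟩ 1 rfl, rho] at h
    have : (1 : ℝ) - 2 * ((r - ((0 : ℕ) : ℝ)) / (2 * (r + 1))) = 1 / (r + 1) := by
      field_simp; push_cast; ring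
    simp only at h
    rw [this] at h
    exact absurd h (not_lt.2 (by positivity))
  by_cases hjr : j = r
  · subst hjr
    rw [alphaF, if_neg h0, if_pos rfl] at h
    rw [cd_eq _ ⟨j-1, by omega⟩ j (by simp; omega)] at h
    have := (rho_mem j).2 ⟨j-1, by omega⟩
    linarith
  · rw [alphaF, if_neg h0, if_neg hjr, cd_eq _ ⟨j-1, by omega⟩ j (by simp; omega),
      cd_eq _ ⟨j, by omega⟩ (j+1) rfl] at h
    have := (rho_mem r).1 ⟨j-1, by omega⟩ ⟨j, by omega⟩ (by rw [Fin.le_def]; simp)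
    linarith

/-- Deletion for a simple root. -/
lemma deletionS {r : ℕ} (hr : 2 ≤ r) {c : E r} (hc : c ∈ CplusCl r) {j : ℕ} (hj : j ≤ r)
    {v : List ℕ} (hv : OKw r v) (h : alphaF r j (wordAct r v c) < 0) :
    ∃ w : List ℕ, w.Sublist v ∧ w.length + 1 = v.length ∧
      ∀ y, genF r j (wordAct r v y) = wordAct r w y := by
  obtain ⟨a, h0, h1, h2⟩ := exRootPos hr hj
  obtain ⟨w, k1, k2, k3⟩ := deletion hr hv a h0 (neg_at_rho hr hc hv a (by rwa [h1]))
  exact ⟨w, k1, k2, fun y => by rw [← h2, k3]⟩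

/-- Ascending words from `c`. -/
def Asc (r : ℕ) (c : E r) : List ℕ → Prop
  | [] => True
  | j :: l => 0 < alphaF r j (wordAct r l c) ∧ Asc r c l

lemma asc_sub {r : ℕ} (hr : 2 ≤ r) {c : E r} (hc : c ∈ CplusCl r) :
    ∀ n (m : List ℕ), m.length ≤ n → OKw r m →
      ∃ m' : List ℕ, m'.Sublist m ∧ Asc r c m' ∧ wordAct r m' c = wordAct r m c := by
  intro n
  induction n with
  | zero =>
    intro m hm _
    obtain rfl : m = [] := List.eq_nil_of_length_eq_zero (by omega)
    exact ⟨[], List.Sublist.refl _, trivial, rfl⟩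
  | succ n ih =>
    intro m hm ho
    cases m with
    | nil => exact ⟨[], List.Sublist.refl _, trivial, rfl⟩
    | cons j v =>
      simp only [List.length_cons] at hm
      obtain ⟨v', s1, s2, s3⟩ := ih v (by omega) ho.tail
      rcases lt_trichotomy (alphaF r j (wordAct r v' c)) 0 with h | h | h
      · obtain ⟨w, k1, k2, k3⟩ := deletionS hr hc ho.head (ho.tail.sub s1) h
        have := s1.length_le
        obtain ⟨w', q1, q2, q3⟩ := ih w (by omega) ((ho.tail.sub s1).sub k1)
        refine ⟨w', (q1.trans (k1.trans s1)).cons j, q2, ?_⟩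
        rw [q3, ← k3, wordAct_cons, s3]
      · refine ⟨v', s1.cons j, s2, ?_⟩
        rw [wordAct_cons, ← s3, genF_fix hr ho.head h]
      · refine ⟨j :: v', s1.cons_cons j, ⟨h, s2⟩, ?_⟩
        rw [wordAct_cons, wordAct_cons, s3]

lemma asc_min {r : ℕ} (hr : 2 ≤ r) {c : E r} (hc : c ∈ CplusCl r) (l : List ℕ) (hl : OKw r l)
    (ha : Asc r c l) : ∀ (m : List ℕ), OKw r m → wordAct r m c = wordAct r l c →
      l.length ≤ m.length := by
  induction l with
  | nil => intro m _ _; simp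
  | cons j v ih =>
    intro m hm he
    have h1 : alphaF r j (wordAct r m c) < 0 := by
      rw [he, wordAct_cons, alphaF_genF hr hl.head]; have := ha.1; linarith
    obtain ⟨w, k1, k2, k3⟩ := deletionS hr hc hl.head hm h1
    have := ih hl.tail ha.2 w (hm.sub k1) (by
      rw [← k3, he, wordAct_cons, genF_genF hr hl.head])
    simp only [List.length_cons]; omega

lemma asc_unique {r : ℕ} (hr : 2 ≤ r) {c : E r} (hc : c ∈ CplusCl r) (l : List ℕ) (hl : OKw r l)
    (ha : Asc r c l) : ∀ (m : List ℕ), OKw r m → Asc r c m → wordAct r m c = wordAct r l c →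
      ∀ y, wordAct r m y = wordAct r l y := by
  induction l with
  | nil =>
    intro m hm hma he
    have := asc_min hr hc m hm hma [] hl he.symm
    obtain rfl : m = [] := List.eq_nil_of_length_eq_zero (by simpa using this)
    exact fun _ => rfl
  | cons j v ih =>
    intro m hm hma he y
    have h1 : alphaF r j (wordAct r m c) < 0 := by
      rw [he, wordAct_cons, alphaF_genF hr hl.head]; have := ha.1; linarith
    obtain ⟨w, k1, k2, k3⟩ := deletionS hr hc hl.head hm h1
    obtain ⟨w', q1, q2, q3⟩ := asc_sub hr hc _ w le_rfl (hm.sub k1)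
    have hw : wordAct r w c = wordAct r v c := by
      rw [← k3, he, wordAct_cons, genF_genF hr hl.head]
    have hlen := asc_min hr hc m hm hma (j :: w') (OKw.cons hl.head ((hm.sub k1).sub q1)) (by
      rw [wordAct_cons, q3, hw, he, wordAct_cons])
    simp only [List.length_cons] at hlen
    have hle := q1.length_le
    obtain rfl : w' = w := q1.eq_of_length (by omega)
    have := ih hl.tail ha.2 w' (hm.sub k1) q2 hw y
    rw [wordAct_cons, ← this, ← k3, genF_genF hr hl.head]

lemma stab {r : ℕ} (hr : 2 ≤ r) {c c' : E r} (hc : c ∈ CplusCl r) (hc' : c' ∈ CplusCl r) :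
    ∀ n (u : List ℕ), u.length ≤ n → OKw r u → wordAct r u c = c' →
      c = c' ∧ ∃ w : List ℕ, (∀ a ∈ w, a ≤ r ∧ alphaF r a c = 0) ∧
        ∀ y, wordAct r u y = wordAct r w y := by
  intro n
  induction n with
  | zero =>
    intro m hm _ h
    obtain rfl : m = [] := List.eq_nil_of_length_eq_zero (by omega)
    exact ⟨h, [], by simp, fun _ => rfl⟩
  | succ n ih =>
    intro m hm ho h
    cases m with
    | nil => exact ⟨h, [], by simp, fun _ => rfl⟩
    | cons j v =>
      simp only [List.length_cons] at hm
      have hv : wordAct r v c = genF r j c' := by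
        rw [← h, wordAct_cons, genF_genF hr ho.head]
      obtain ⟨a, h0, h1, h2⟩ := exRootPos hr ho.head
      have hp := a.nonneg_of_pos h0 hc'
      rw [h1] at hp
      rcases hp.eq_or_lt with hp | hp
      · rw [genF_fix hr ho.head hp.symm] at hv
        obtain ⟨rfl, w, w1, w2⟩ := ih v (by omega) ho.tail hv
        refine ⟨rfl, j :: w, ?_, fun y => by rw [wordAct_cons, wordAct_cons, w2]⟩
        intro b hb
        rcases List.mem_cons.1 hb with rfl | hb
        · exact ⟨ho.head, hp.symm⟩
        · exact w1 b hb
      · have hneg : alphaF r j (wordAct r v c) < 0 := by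
          rw [hv, alphaF_genF hr ho.head]; linarith
        obtain ⟨w, k1, k2, k3⟩ := deletionS hr hc ho.head ho.tail hneg
        obtain ⟨e, w', q1, q2⟩ := ih w (by omega) (ho.tail.sub k1) (by rw [← k3]; exact h)
        exact ⟨e, w', q1, fun y => by rw [wordAct_cons, k3, q2]⟩

lemma wlen_le {r : ℕ} {m : List ℕ} (hm : OKw r m) : wlen r (fun y => wordAct r m y) ≤ m.length :=
  Nat.sInf_le ⟨m, hm, rfl, rfl⟩

lemma wlen_asc {r : ℕ} (hr : 2 ≤ r) {c : E r} (hc : c ∈ CplusCl r) {l : List ℕ} (hl : OKw r l)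
    (ha : Asc r c l) : l.length = wlen r (fun y => wordAct r l y) := by
  apply le_antisymm _ (wlen_le hl)
  have hne : {n | ∃ m : List ℕ, (∀ a ∈ m, a ≤ r) ∧ m.length = n ∧
      (fun y => wordAct r m y) = fun y => wordAct r l y}.Nonempty := ⟨_, l, hl, rfl, rfl⟩
  obtain ⟨m, h1, h2, h3⟩ := Nat.sInf_mem hne
  rw [wlen, ← h2]
  exact asc_min hr hc l hl ha m h1 (congrFun h3 c)

lemma gW_spec {r : ℕ} (hr : 2 ≤ r) {c : E r} (hc : c ∈ CplusCl r) {l : List ℕ} (hl : OKw r l) :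
    OKw r (gW r (wordAct r l c)) ∧ wordAct r (gW r (wordAct r l c)) c = wordAct r l c ∧
      Asc r c (gW r (wordAct r l c)) := by
  set y := wordAct r l c with hy
  have hex : ∃ l : List ℕ, (∀ a ∈ l, a ≤ r) ∧ wordAct r l.reverse y ∈ CplusCl r ∧
      ∀ l' : List ℕ, (∀ a ∈ l', a ≤ r) → wordAct r l'.reverse y ∈ CplusCl r →
        l.length ≤ l'.length := by
    have hne : ∃ n, ∃ l : List ℕ, l.length = n ∧ (∀ a ∈ l, a ≤ r) ∧
        wordAct r l.reverse y ∈ CplusCl r := ⟨_, l, rfl, hl, by rw [hy, wordAct_rev hr hl]; exact hc⟩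
    obtain ⟨l0, h1, h2, h3⟩ := Nat.find_spec hne
    refine ⟨l0, h2, h3, fun l' h4 h5 => ?_⟩
    rw [h1]; exact Nat.find_min' hne ⟨l', rfl, h4, h5⟩
  have hg : gW r y = hex.choose := by rw [gW, dif_pos hex]
  obtain ⟨h1, h2, h3⟩ := hex.choose_spec
  rw [← hg] at h1 h2 h3
  have h1' : OKw r (gW r y) := h1
  obtain ⟨e, -⟩ := stab hr hc h2 _ ((gW r y).reverse ++ l) le_rfl (h1'.rev.app hl) (by
    rw [wordAct_append])
  have himg : wordAct r (gW r y) c = y := by rw [e, wordAct_rev' hr h1']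
  refine ⟨h1, himg, ?_⟩
  obtain ⟨m, s1, s2, s3⟩ := asc_sub hr hc _ (gW r y) le_rfl h1
  have := h3 m (h1'.sub s1) (by
    rw [← himg, ← s3, wordAct_rev hr (h1'.sub s1)]; exact hc)
  obtain rfl : m = gW r y := s1.eq_of_length (le_antisymm s1.length_le this)
  exact s2

/-- Minimal coset representatives give ascending words. -/
lemma asc_of_min {r : ℕ} (hr : 2 ≤ r) {O : Set (E r)} (hc : cpt r O ∈ CplusCl r) {l : List ℕ}
    (hl : OKw r l) (hred : l.length = wlen r (fun y => wordAct r l y))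
    (hmin : ∀ u, IsWJfun r O u →
        wlen r (fun y => wordAct r l y) ≤ wlen r (fun y => wordAct r l (u y))) :
    Asc r (cpt r O) l := by
  obtain ⟨m, s1, s2, s3⟩ := asc_sub hr hc _ l le_rfl hl
  have hm := hl.sub s1
  obtain ⟨-, w, w1, w2⟩ := stab hr hc hc _ (l.reverse ++ m) le_rfl (hl.rev.app hm) (by
    rw [wordAct_append, s3, wordAct_rev hr hl])
  have := hmin (fun y => wordAct r w y) ⟨w, w1, rfl⟩
  have e : (fun y => wordAct r l (wordAct r w y)) = fun y => wordAct r m y := by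
    funext y
    rw [← w2, wordAct_append, wordAct_rev' hr hl]
  simp only [e] at this
  have h2 := wlen_le hm
  obtain rfl : m = l := s1.eq_of_length (le_antisymm s1.length_le (by omega))
  exact s2

/-! ### The order -/

/-- One reflection step downwards. -/
def stp (r : ℕ) (y' y : E r) : Prop := ∃ a : Rt r, 0 < a.ev (rho r) ∧ a.ev y < 0 ∧ y' = a.rf y

/-- The strict order generated by the reflection steps. -/
def lt' (r : ℕ) : E r → E r → Prop := Relation.TransGen (stp r)

lemma lt_sub {r : ℕ} (hr : 2 ≤ r) {c : E r} (hc : c ∈ CplusCl r) {y y' : E r} (h : lt' r y' y) :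
    ∀ l : List ℕ, OKw r l → wordAct r l c = y →
      ∃ l' : List ℕ, l'.Sublist l ∧ l'.length < l.length ∧ wordAct r l' c = y' := by
  have one : ∀ {y y' : E r}, stp r y' y → ∀ l : List ℕ, OKw r l → wordAct r l c = y →
      ∃ l' : List ℕ, l'.Sublist l ∧ l'.length < l.length ∧ wordAct r l' c = y' := by
    rintro y y' ⟨a, h1, h2, rfl⟩ l hl rfl
    obtain ⟨w, k1, k2, k3⟩ := deletion hr hl a h1 (neg_at_rho hr hc hl a h2)
    exact ⟨w, k1, by omega, (k3 c).symm⟩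
  induction h using Relation.TransGen.head_induction_on with
  | single h => exact one h
  | head h1 _ ih =>
    intro l hl he
    obtain ⟨l', a1, a2, a3⟩ := ih l hl he
    obtain ⟨l'', b1, b2, b3⟩ := one h1 l' (hl.sub a1) a3
    exact ⟨l'', b1.trans a1, b2.trans a2, b3⟩

lemma qlt_of_lt {r : ℕ} (hr : 2 ≤ r) {c : E r} (hc : c ∈ CplusCl r) {l : List ℕ} (hl : OKw r l)
    {y' : E r} (h : lt' r y' (wordAct r l c)) : qlt r y' (wordAct r l c) := by
  obtain ⟨g1, g2, g3⟩ := gW_spec hr hc hl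
  set y := wordAct r l c with hy
  obtain ⟨l1, a1, a2, a3⟩ := lt_sub hr hc h _ g1 g2
  have o1 := g1.sub a1
  obtain ⟨l2, b1, b2, b3⟩ := asc_sub hr hc _ l1 le_rfl o1
  have o2 := o1.sub b1
  have hy' : wordAct r l2 c = y' := by rw [b3, a3]
  obtain ⟨p1, p2, p3⟩ := gW_spec hr hc o2
  rw [hy'] at p1 p2 p3
  have hfun : ∀ z, wordAct r l2 z = wordAct r (gW r y') z :=
    asc_unique hr hc _ p1 p3 l2 o2 b2 (by rw [hy', p2])
  refine ⟨⟨⟨l2 ++ (gW r y).reverse, o2.app g1.rev, ?_⟩, gW r y, g1, rfl, ?_, l2,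
    b1.trans a1, ?_, ?_⟩, ?_⟩
  · have e := wordAct_rev hr g1 c
    rw [g2] at e
    rw [wordAct_append, e, hy']
  · exact wlen_asc hr hc g1 g3
  · funext z; exact hfun z
  · have : gfun r y' = fun z => wordAct r l2 z := by funext z; exact (hfun z).symm
    rw [this]; exact wlen_asc hr hc o2 b2
  · intro he
    have := asc_min hr hc _ g1 g3 l1 o1 (by rw [a3, he, g2])
    omega

lemma stp_lift {r : ℕ} (hr : 2 ≤ r) {j : ℕ} (hj : j ≤ r) {y y' : E r} (h : stp r y' y) :
    stp r (genF r j y') (genF r j y) ∨ genF r j y' = y := by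
  obtain ⟨a, h1, h2, rfl⟩ := h
  obtain ⟨g, hg⟩ := exSP hr hj
  have e : genF r j (a.rf y) = (a.comp g).rf (genF r j y) := by
    conv_lhs => rw [← genF_genF hr hj y, hg (genF r j y), Rt.rf_act, ← hg, genF_genF hr hj]
  rcases pos_or_neg (a.comp g) with hp | hp
  · left
    refine ⟨a.comp g, hp, ?_, e⟩
    rw [Rt.ev_comp, ← hg, genF_genF hr hj]; exact h2
  · right
    rw [Rt.ev_comp, ← hg] at hp
    rw [a.simple_of hr hj h1 hp, genF_genF hr hj]

lemma lt_lift {r : ℕ} (hr : 2 ≤ r) {j : ℕ} (hj : j ≤ r) {y y' : E r} (h : lt' r y' y) :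
    lt' r (genF r j y') (genF r j y) ∨ genF r j y' = y ∨ lt' r (genF r j y') y := by
  induction h using Relation.TransGen.head_induction_on with
  | single h =>
    rcases stp_lift hr hj h with h | h
    · exact Or.inl (Relation.TransGen.single h)
    · exact Or.inr (Or.inl h)
  | head h1 h2 ih =>
    rcases stp_lift hr hj h1 with h | h
    · rcases ih with ih | ih | ih
      · exact Or.inl (Relation.TransGen.head h ih)
      · rw [ih] at h; exact Or.inr (Or.inr (Relation.TransGen.single h))
      · exact Or.inr (Or.inr (Relation.TransGen.head h ih))
    · right; right; rw [h]; exact h2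

lemma not_lt_c {r : ℕ} {c : E r} (hc : c ∈ CplusCl r) (y' : E r) : ¬ lt' r y' c := by
  intro h
  obtain ⟨z, -, a, h1, h2, -⟩ := Relation.TransGen.tail'_iff.1 h
  exact absurd (a.nonneg_of_pos h1 hc) (not_le.2 h2)

/-! ### Pair sums -/

/-- A sum over pairs of coordinates. -/
def PS {r : ℕ} (a b : ℝ → ℤ) (z : E r) : ℤ :=
  (∑ i : Fin r, ∑ j : Fin r, if i < j then a (z i - z j) + a (z i + z j) else 0) +
    ∑ i : Fin r, b (z i)

lemma PS_last {r : ℕ} (hr : 2 ≤ r) (a b : ℝ → ℤ) (z : E r) (q : Fin r) (hq : (q : ℕ) + 1 = r) :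
    PS a b (genF r r z) = PS a b z - b (z q) + b (- z q) := by
  have e1 : (∑ i : Fin r, ∑ j : Fin r, if i < j then
        a (genF r r z i - genF r r z j) + a (genF r r z i + genF r r z j) else 0) =
      ∑ i : Fin r, ∑ j : Fin r, if i < j then a (z i - z j) + a (z i + z j) else 0 := by
    refine Finset.sum_congr rfl fun i _ => Finset.sum_congr rfl fun j _ => ?_
    split_ifs with h
    · have hi : (i : ℕ) + 1 ≠ r := by have := j.2; rw [Fin.lt_def] at h; omega
      rw [genF_last hr, genF_last hr, if_neg hi]
      split_ifs
      · rw [sub_neg_eq_add, ← sub_eq_add_neg, add_comm]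
      · rfl
    · rfl
  have e2 : (∑ i : Fin r, b (genF r r z i)) = (∑ i : Fin r, b (z i)) +
      ∑ i : Fin r, if i = q then (- b (z q) + b (- z q)) else 0 := by
    rw [← Finset.sum_add_distrib]
    refine Finset.sum_congr rfl fun i _ => ?_
    rw [genF_last hr]
    by_cases h : i = q
    · subst h; rw [if_pos hq, if_pos rfl]; ring
    · rw [if_neg h, if_neg (fun h' => h (Fin.ext (by omega))), add_zero]
  rw [PS, e1, e2, PS]
  simp only [Finset.sum_ite_eq', Finset.mem_univ, if_true]
  ring

lemma PS_zero {r : ℕ} (a b : ℝ → ℤ) (z : E r) (o : Fin r) (ho : (o : ℕ) = 0) :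
    PS a b (genF r 0 z) = PS a b z +
      (∑ m : Fin r, if 1 ≤ (m : ℕ) then (a (1 - (z o + z m)) - a (z o + z m)) +
        (a (1 - (z o - z m)) - a (z o - z m)) else 0) - b (z o) + b (1 - z o) := by
  have e1 : (∑ i : Fin r, ∑ j : Fin r, if i < j then
        a (genF r 0 z i - genF r 0 z j) + a (genF r 0 z i + genF r 0 z j) else 0) =
      (∑ i : Fin r, ∑ j : Fin r, if i < j then a (z i - z j) + a (z i + z j) else 0) +
      ∑ i : Fin r, if i = o then (∑ m : Fin r, if 1 ≤ (m : ℕ) then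
        (a (1 - (z o + z m)) - a (z o + z m)) + (a (1 - (z o - z m)) - a (z o - z m)) else 0)
        else 0 := by
    rw [← Finset.sum_add_distrib]
    refine Finset.sum_congr rfl fun i _ => ?_
    by_cases hi : i = o
    · subst hi
      rw [if_pos rfl, ← Finset.sum_add_distrib]
      refine Finset.sum_congr rfl fun j _ => ?_
      by_cases hj : 1 ≤ (j : ℕ)
      · have h : i < j := by rw [Fin.lt_def]; omega
        rw [if_pos h, if_pos h, if_pos hj, genF_zero, genF_zero, if_pos ho,
          if_neg (by omega : ¬ (j : ℕ) = 0), sub_sub, sub_add]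
        ring
      · have h : ¬ i < j := by rw [Fin.lt_def]; omega
        rw [if_neg h, if_neg h, if_neg hj, add_zero]
    · have hi' : (i : ℕ) ≠ 0 := fun h => hi (Fin.ext (by omega))
      rw [if_neg hi, add_zero]
      refine Finset.sum_congr rfl fun j _ => ?_
      by_cases h : i < j
      · have hj' : (j : ℕ) ≠ 0 := by rw [Fin.lt_def] at h; omega
        rw [if_pos h, if_pos h, genF_zero, genF_zero, if_neg hi', if_neg hj']
      · rw [if_neg h, if_neg h]
  have e2 : (∑ i : Fin r, b (genF r 0 z i)) = (∑ i : Fin r, b (z i)) +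
      ∑ i : Fin r, if i = o then (- b (z o) + b (1 - z o)) else 0 := by
    rw [← Finset.sum_add_distrib]
    refine Finset.sum_congr rfl fun i _ => ?_
    rw [genF_zero]
    by_cases h : i = o
    · subst h; rw [if_pos ho, if_pos rfl]; ring
    · rw [if_neg h, if_neg (fun h' => h (Fin.ext (by omega))), add_zero]
  rw [PS, e1, e2, PS]
  simp only [Finset.sum_ite_eq', Finset.mem_univ, if_true]
  ring

lemma PS_mid {r : ℕ} {j : ℕ} (a b : ℝ → ℤ) (z : E r) (p q : Fin r) (hp : (p : ℕ) + 1 = j)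
    (hq : (q : ℕ) = j) :
    PS a b (genF r j z) = PS a b z - a (z p - z q) + a (-(z p - z q)) := by
  have h2 : j < r := by have := q.2; omega
  have hg : ∀ m, genF r j z m = z (Equiv.swap p q m) := by
    intro m
    rw [genF_mid (by omega) (by omega) h2]
    have hp' : (⟨j-1, by omega⟩ : Fin r) = p := Fin.ext (by simp; omega)
    have hq' : (⟨j, h2⟩ : Fin r) = q := Fin.ext (by simp; omega)
    rw [hp', hq', Equiv.swap_apply_def]
    simp only [Fin.ext_iff]
    split_ifs <;> first | omega | rfl
  have hpq : p ≠ q := fun h => by rw [h] at hp; omega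
  set G : Fin r → Fin r → ℤ := fun i j => a (z i - z j) + a (z i + z j) with hG
  have e2 : (∑ i : Fin r, b (genF r j z i)) = (∑ i : Fin r, b (z i)) := by
    simp only [hg]
    exact Equiv.sum_comp (Equiv.swap p q) (fun i => b (z i))
  have e1 : (∑ i : Fin r, ∑ l : Fin r, if i < l then
        a (genF r j z i - genF r j z l) + a (genF r j z i + genF r j z l) else 0) =
      (∑ i : Fin r, ∑ l : Fin r, if i < l then G i l else 0)
      + (∑ i : Fin r, if i = p then (∑ l : Fin r, if l = q then - G p q else 0) else 0)
      + (∑ i : Fin r, if i = q then (∑ l : Fin r, if l = p then G q p else 0) else 0) := by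
    have : (∑ i : Fin r, ∑ l : Fin r, if i < l then
        a (genF r j z i - genF r j z l) + a (genF r j z i + genF r j z l) else 0) =
        ∑ i : Fin r, ∑ l : Fin r, if Equiv.swap p q i < Equiv.swap p q l then G i l else 0 := by
      rw [← Equiv.sum_comp (Equiv.swap p q)]
      refine Finset.sum_congr rfl fun i _ => ?_
      rw [← Equiv.sum_comp (Equiv.swap p q)]
      refine Finset.sum_congr rfl fun l _ => ?_
      simp only [hg, Equiv.swap_apply_self, hG]
    rw [this, ← Finset.sum_add_distrib, ← Finset.sum_add_distrib]
    refine Finset.sum_congr rfl fun i _ => ?_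
    have hsw : ∀ m, ((Equiv.swap p q m : Fin r) : ℕ) = if m = p then j else if m = q then j - 1
        else m := by
      intro m
      rw [Equiv.swap_apply_def]
      split_ifs <;> omega
    have hlt : ∀ i l : Fin r, (Equiv.swap p q i < Equiv.swap p q l) ↔
        ((i < l ∧ ¬ (i = p ∧ l = q)) ∨ (i = q ∧ l = p)) := by
      intro i l
      rw [Fin.lt_def, Fin.lt_def, hsw, hsw]
      simp only [Fin.ext_iff]
      split_ifs <;> omega
    simp only [hlt]
    by_cases hi : i = p
    · subst hi
      simp only [hpq, if_true, if_false, add_zero]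
      rw [← Finset.sum_add_distrib]
      refine Finset.sum_congr rfl fun l _ => ?_
      by_cases hl : l = q
      · subst hl
        have : i < l := by rw [Fin.lt_def]; omega
        simp [this, hpq]
      · simp [hl, hpq]
    · by_cases hi' : i = q
      · subst hi'
        simp only [hi, if_true, if_false, add_zero]
        rw [← Finset.sum_add_distrib]
        refine Finset.sum_congr rfl fun l _ => ?_
        by_cases hl : l = p
        · subst hl
          have : ¬ i < l := by rw [Fin.lt_def]; omega
          simp [this, hi]
        · simp [hl, hi]
      · simp [hi, hi']
  rw [PS, e1, e2, PS]
  simp only [Finset.sum_ite_eq', Finset.mem_univ, if_true, hG]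
  rw [add_comm (z q) (z p), neg_sub]
  ring

/-! ### Existence of the alcove point -/

/-- Auxiliary height function. -/
def hfn (v : ℝ) : ℤ := ⌈max v (1 - v)⌉ - 1

lemma hfn_nonneg (v : ℝ) : 0 ≤ hfn v := by
  have h : (0 : ℝ) < max v (1 - v) := by
    by_contra h
    push Not at h
    have := max_le_iff.1 h
    linarith [this.1, this.2]
  have := Int.ceil_pos.2 h
  unfold hfn; omega

lemma hfn_one_sub (v : ℝ) : hfn (1 - v) = hfn v := by
  unfold hfn
  rw [sub_sub_cancel, max_comm]

lemma hfn_neg {v : ℝ} (h : v < 0) : hfn (-v) < hfn v := by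
  unfold hfn
  rw [max_eq_right (a := v) (by linarith)]
  have e : ⌈1 - v⌉ = 1 + ⌈-v⌉ := by
    rw [sub_eq_add_neg, add_comm, Int.ceil_add_one]; ring
  have h1 : 0 < ⌈-v⌉ := Int.ceil_pos.2 (by linarith)
  have : ⌈max (-v) (1 - -v)⌉ ≤ ⌈-v⌉ := by
    apply Int.ceil_le.2
    apply max_le (Int.le_ceil _)
    have : (1 : ℝ) ≤ ⌈-v⌉ := by exact_mod_cast h1
    linarith
  omega

lemma hfn_two_sub {v : ℝ} (h : 1 < v) : hfn (2 - v) < hfn v := by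
  have := hfn_neg (v := 1 - v) (by linarith)
  rw [hfn_one_sub] at this
  rwa [← hfn_one_sub (2 - v), show (1 : ℝ) - (2 - v) = -(1 - v) by ring]

lemma PS_desc {r : ℕ} (hr : 2 ≤ r) {j : ℕ} (hj : j ≤ r) (z : E r) (h : alphaF r j z < 0) :
    PS hfn (fun x => hfn (2 * x)) (genF r j z) < PS hfn (fun x => hfn (2 * x)) z := by
  by_cases h0 : j = 0
  · subst h0
    rw [alphaF, if_pos rfl, cd_eq z ⟨0, by omega⟩ 1 rfl] at h
    rw [PS_zero _ _ z ⟨0, by omega⟩ rfl]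
    simp only [hfn_one_sub, sub_self, add_zero, ite_self, Finset.sum_const_zero]
    have := hfn_two_sub (v := 2 * z ⟨0, by omega⟩) (by linarith)
    rw [mul_sub, mul_one]
    linarith
  by_cases hjr : j = r
  · subst hjr
    rw [alphaF, if_neg h0, if_pos rfl, cd_eq z ⟨j-1, by omega⟩ j (by simp; omega)] at h
    rw [PS_last hr _ _ z ⟨j-1, by omega⟩ (by simp; omega)]
    have := hfn_neg h
    rw [mul_neg]
    linarith
  · rw [alphaF, if_neg h0, if_neg hjr, cd_eq z ⟨j-1, by omega⟩ j (by simp; omega),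
      cd_eq z ⟨j, by omega⟩ (j+1) rfl] at h
    rw [PS_mid _ _ z ⟨j-1, by omega⟩ ⟨j, by omega⟩ (by simp; omega) rfl]
    have := hfn_neg h
    linarith

lemma PS_nonneg {r : ℕ} (z : E r) : 0 ≤ PS hfn (fun x => hfn (2 * x)) z := by
  unfold PS
  apply add_nonneg
  · refine Finset.sum_nonneg fun i _ => Finset.sum_nonneg fun j _ => ?_
    split_ifs
    · exact add_nonneg (hfn_nonneg _) (hfn_nonneg _)
    · exact le_rfl
  · exact Finset.sum_nonneg fun i _ => hfn_nonneg _

lemma exists_alcove {r : ℕ} (hr : 2 ≤ r) : ∀ (n : ℕ) (y : E r),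
    PS hfn (fun x => hfn (2 * x)) y ≤ n → ∃ l, OKw r l ∧ wordAct r l y ∈ CplusCl r := by
  intro n
  induction n with
  | zero =>
    intro y hy
    refine ⟨[], by simp [OKw], mem_of_alpha hr fun j hj => ?_⟩
    by_contra h
    have := PS_desc hr hj y (not_le.1 h)
    have := PS_nonneg (genF r j y)
    push_cast at hy
    linarith
  | succ n ih =>
    intro y hy
    by_cases hc : ∀ j, j ≤ r → 0 ≤ alphaF r j y
    · exact ⟨[], by simp [OKw], mem_of_alpha hr hc⟩
    · push Not at hc
      obtain ⟨j, hj, h⟩ := hc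
      have := PS_desc hr hj y h
      obtain ⟨l, l1, l2⟩ := ih (genF r j y) (by push_cast at hy; linarith)
      exact ⟨l ++ [j], l1.app (OKw.cons hj (by simp [OKw])), by rw [wordAct_append]; exact l2⟩

lemma cpt_mem {r : ℕ} (hr : 2 ≤ r) {O : Set (E r)} (hO : IsOrbit r O) : cpt r O ∈ CplusCl r := by
  obtain ⟨y, rfl⟩ := hO
  obtain ⟨l, l1, l2⟩ := exists_alcove hr (PS hfn (fun x => hfn (2 * x)) y).toNat y
    (Int.self_le_toNat _)
  have h : ∃ c, c ∈ orbit r y ∧ c ∈ CplusCl r := ⟨_, ⟨l, l1, rfl⟩, l2⟩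
  rw [cpt, dif_pos h]
  exact h.choose_spec.2

/-! ### The sign functions -/

lemma etaE_even (n : ℤ) : etaE (2 * n) = if 1 ≤ n then 1 else -1 := by
  have : ((2 : ℝ) ≤ 2 * n) ↔ 1 ≤ n := by
    constructor
    · intro h; have : (1 : ℝ) ≤ n := by linarith
      exact_mod_cast this
    · intro h; have : (1 : ℝ) ≤ n := by exact_mod_cast h
      linarith
  rw [etaE, if_pos ⟨n, rfl⟩]
  simp only [this]

lemma etaO_odd (n : ℤ) : etaO (2 * n + 1) = if 0 ≤ n then 1 else -1 := by
  have : ((1 : ℝ) ≤ 2 * n + 1) ↔ 0 ≤ n := by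
    constructor
    · intro h; have : (0 : ℝ) ≤ n := by linarith
      exact_mod_cast this
    · intro h; have : (0 : ℝ) ≤ n := by exact_mod_cast h
      linarith
  rw [etaO, if_pos ⟨n, rfl⟩]
  simp only [this]

lemma etaE_odd (n : ℤ) : etaE (2 * n + 1) = 0 := by
  rw [etaE, if_neg]
  rintro ⟨m, h⟩
  have : (2 * n + 1 : ℤ) = 2 * m := by exact_mod_cast h
  omega

lemma etaO_even (n : ℤ) : etaO (2 * n) = 0 := by
  rw [etaO, if_neg]
  rintro ⟨m, h⟩
  have : (2 * n : ℤ) = 2 * m + 1 := by exact_mod_cast h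
  omega

lemma etaE_not {z : ℝ} (h : ¬ ∃ n : ℤ, z = n) : etaE z = 0 := by
  rw [etaE, if_neg]
  rintro ⟨m, rfl⟩
  exact h ⟨2 * m, by push_cast; rfl⟩

lemma etaO_not {z : ℝ} (h : ¬ ∃ n : ℤ, z = n) : etaO z = 0 := by
  rw [etaO, if_neg]
  rintro ⟨m, rfl⟩
  exact h ⟨2 * m + 1, by push_cast; rfl⟩

lemma eta_not {z : ℝ} (h : ¬ ∃ n : ℤ, z = n) : eta z = 0 := by
  rw [eta, etaE_not h, etaO_not h]; rfl

lemma eta_int (n : ℤ) : eta n = if 1 ≤ n then 1 else -1 := by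
  rcases Int.even_or_odd' n with ⟨m, rfl | rfl⟩
  · rw [eta]; push_cast; rw [etaE_even, etaO_even]; split_ifs <;> omega
  · rw [eta]; push_cast; rw [etaE_odd, etaO_odd]; split_ifs <;> omega

lemma real_cases (z : ℝ) : (∃ n : ℤ, z = 2 * n) ∨ (∃ n : ℤ, z = 2 * n + 1) ∨ ¬ ∃ n : ℤ, z = n := by
  by_cases h : ∃ n : ℤ, z = n
  · obtain ⟨n, rfl⟩ := h
    rcases Int.even_or_odd' n with ⟨m, rfl | rfl⟩
    · left; exact ⟨m, by push_cast; rfl⟩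
    · right; left; exact ⟨m, by push_cast; rfl⟩
  · exact Or.inr (Or.inr h)

/-! ### The potential for `k_w(c)` -/

/-- Indicator of the positive integers. -/
def iA (v : ℝ) : ℤ := if (∃ n : ℤ, v = n) ∧ 1 ≤ v then 1 else 0
/-- Indicator of the positive even integers. -/
def iE (v : ℝ) : ℤ := if (∃ n : ℤ, v = 2 * n) ∧ 2 ≤ v then 1 else 0
/-- Indicator of the positive odd integers. -/
def iO (v : ℝ) : ℤ := if (∃ n : ℤ, v = 2 * n + 1) ∧ 1 ≤ v then 1 else 0

lemma not_int_sub {z : ℝ} (h : ¬ ∃ n : ℤ, z = n) (a : ℤ) : ¬ ∃ n : ℤ, (a : ℝ) - z = n := by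
  rintro ⟨n, hn⟩
  exact h ⟨a - n, by push_cast; linarith⟩

lemma iA_int (n : ℤ) : iA n = if 1 ≤ n then 1 else 0 := by
  have : ((1 : ℝ) ≤ n) ↔ 1 ≤ n := by norm_cast
  simp only [iA, this]
  simp

lemma iA_not {z : ℝ} (h : ¬ ∃ n : ℤ, z = n) : iA z = 0 := by
  rw [iA, if_neg]; exact fun h' => h h'.1

lemma iE_even (n : ℤ) : iE (2 * n) = if 1 ≤ n then 1 else 0 := by
  have : ((2 : ℝ) ≤ 2 * n) ↔ 1 ≤ n := by
    constructor
    · intro h; have : (1 : ℝ) ≤ n := by linarith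
      exact_mod_cast this
    · intro h; have : (1 : ℝ) ≤ n := by exact_mod_cast h
      linarith
  simp only [iE, this]
  have : ∃ m : ℤ, (2 : ℝ) * n = 2 * m := ⟨n, rfl⟩
  simp [this]

lemma iE_odd (n : ℤ) : iE (2 * n + 1) = 0 := by
  rw [iE, if_neg]
  rintro ⟨⟨m, h⟩, -⟩
  have : (2 * n + 1 : ℤ) = 2 * m := by exact_mod_cast h
  omega

lemma iO_odd (n : ℤ) : iO (2 * n + 1) = if 0 ≤ n then 1 else 0 := by
  have : ((1 : ℝ) ≤ 2 * n + 1) ↔ 0 ≤ n := by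
    constructor
    · intro h; have : (0 : ℝ) ≤ n := by linarith
      exact_mod_cast this
    · intro h; have : (0 : ℝ) ≤ n := by exact_mod_cast h
      linarith
  simp only [iO, this]
  have : ∃ m : ℤ, (2 : ℝ) * n + 1 = 2 * m + 1 := ⟨n, rfl⟩
  simp [this]

lemma iO_even (n : ℤ) : iO (2 * n) = 0 := by
  rw [iO, if_neg]
  rintro ⟨⟨m, h⟩, -⟩
  have : (2 * n : ℤ) = 2 * m + 1 := by exact_mod_cast h
  omega

lemma iE_not {z : ℝ} (h : ¬ ∃ n : ℤ, z = n) : iE z = 0 := by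
  rw [iE, if_neg]
  rintro ⟨⟨m, rfl⟩, -⟩
  exact h ⟨2 * m, by push_cast; rfl⟩

lemma iO_not {z : ℝ} (h : ¬ ∃ n : ℤ, z = n) : iO z = 0 := by
  rw [iO, if_neg]
  rintro ⟨⟨m, rfl⟩, -⟩
  exact h ⟨2 * m + 1, by push_cast; rfl⟩

lemma iA_one_sub (v : ℝ) : iA (1 - v) - iA v = - eta v := by
  by_cases h : ∃ n : ℤ, v = n
  · obtain ⟨n, rfl⟩ := h
    rw [show (1 : ℝ) - n = ((1 - n : ℤ) : ℝ) by push_cast; ring, iA_int, iA_int, eta_int]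
    split_ifs <;> omega
  · have := not_int_sub h 1
    push_cast at this
    rw [iA_not h, iA_not this, eta_not h]; rfl

lemma iA_neg {v : ℝ} (hv : 0 < v) : - iA v + iA (-v) = - eta v := by
  by_cases h : ∃ n : ℤ, v = n
  · obtain ⟨n, rfl⟩ := h
    have hn : 0 < n := by exact_mod_cast hv
    rw [show -(n : ℝ) = ((- n : ℤ) : ℝ) by push_cast; ring, iA_int, iA_int, eta_int]
    split_ifs <;> omega
  · have := not_int_sub h 0
    push_cast at this
    rw [zero_sub] at this
    rw [iA_not h, iA_not this, eta_not h]; rfl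

lemma iE_neg {v : ℝ} (hv : 0 < v) : - iE v + iE (-v) = - etaE v := by
  rcases real_cases v with ⟨n, rfl⟩ | ⟨n, rfl⟩ | h
  · have hn : 0 < n := by
      have : (0 : ℝ) < n := by linarith
      exact_mod_cast this
    rw [show -(2 * n : ℝ) = 2 * ((- n : ℤ) : ℝ) by push_cast; ring, iE_even, iE_even, etaE_even]
    split_ifs <;> omega
  · rw [show -(2 * n + 1 : ℝ) = 2 * ((- n - 1 : ℤ) : ℝ) + 1 by push_cast; ring, iE_odd, iE_odd,
      etaE_odd]; rfl
  · have := not_int_sub h 0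
    push_cast at this
    rw [zero_sub] at this
    rw [iE_not h, iE_not this, etaE_not h]; rfl

lemma iO_neg {v : ℝ} (hv : 0 < v) : - iO v + iO (-v) = - etaO v := by
  rcases real_cases v with ⟨n, rfl⟩ | ⟨n, rfl⟩ | h
  · rw [show -(2 * n : ℝ) = 2 * ((- n : ℤ) : ℝ) by push_cast; ring, iO_even, iO_even,
      etaO_even]; rfl
  · have hn : 0 < 2 * n + 1 := by exact_mod_cast hv
    rw [show -(2 * n + 1 : ℝ) = 2 * ((- n - 1 : ℤ) : ℝ) + 1 by push_cast; ring, iO_odd, iO_odd,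
      etaO_odd]
    split_ifs <;> omega
  · have := not_int_sub h 0
    push_cast at this
    rw [zero_sub] at this
    rw [iO_not h, iO_not this, etaO_not h]; rfl

lemma iE_two_sub (v : ℝ) : - iE v + iE (2 - v) = - etaE v := by
  rcases real_cases v with ⟨n, rfl⟩ | ⟨n, rfl⟩ | h
  · rw [show 2 - (2 * n : ℝ) = 2 * ((1 - n : ℤ) : ℝ) by push_cast; ring, iE_even, iE_even, etaE_even]
    split_ifs <;> omega
  · rw [show 2 - (2 * n + 1 : ℝ) = 2 * ((- n : ℤ) : ℝ) + 1 by push_cast; ring, iE_odd, iE_odd,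
      etaE_odd]; rfl
  · have := not_int_sub h 2
    push_cast at this
    rw [iE_not h, iE_not this, etaE_not h]; rfl

lemma iO_two_sub {v : ℝ} (hv : v < 1) : - iO v + iO (2 - v) = - etaO v := by
  rcases real_cases v with ⟨n, rfl⟩ | ⟨n, rfl⟩ | h
  · rw [show 2 - (2 * n : ℝ) = 2 * ((1 - n : ℤ) : ℝ) by push_cast; ring, iO_even, iO_even,
      etaO_even]; rfl
  · have hn : 2 * n + 1 < 1 := by exact_mod_cast hv
    rw [show 2 - (2 * n + 1 : ℝ) = 2 * ((- n : ℤ) : ℝ) + 1 by push_cast; ring, iO_odd, iO_odd,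
      etaO_odd]
    split_ifs <;> omega
  · have := not_int_sub h 2
    push_cast at this
    rw [iO_not h, iO_not this, etaO_not h]; rfl

/-- The potential. -/
def pot {F : Type*} [Field F] {r : ℕ} (k kr ur : Fˣ) (z : E r) : Fˣ :=
  k ^ PS iA (fun _ => 0) z * kr ^ PS (fun _ => 0) (fun x => iE (2 * x)) z *
    ur ^ PS (fun _ => 0) (fun x => iO (2 * x)) z

lemma prod_zpow' {G : Type*} [CommGroup G] {ι : Type*} [Fintype ι] (k : G) (f : ι → ℤ) :
    ∏ m, k ^ f m = k ^ ∑ m, f m := by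
  induction (Finset.univ : Finset ι) using Finset.induction_on with
  | empty => simp
  | insert a s ha ih => rw [Finset.prod_insert ha, Finset.sum_insert ha, zpow_add, ih]

lemma comb3 {G : Type*} [CommGroup G] (k kr ur : G) {a b c a1 b1 c1 a2 b2 c2 : ℤ}
    (ha : a = a1 + a2) (hb : b = b1 + b2) (hc : c = c1 + c2) :
    k ^ a * kr ^ b * ur ^ c = (kr ^ b1 * ur ^ c1 * k ^ a1) * (k ^ a2 * kr ^ b2 * ur ^ c2) := by
  rw [ha, hb, hc, zpow_add, zpow_add, zpow_add]
  generalize k ^ a1 = x1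
  generalize k ^ a2 = x2
  generalize kr ^ b1 = y1
  generalize kr ^ b2 = y2
  generalize ur ^ c1 = z1
  generalize ur ^ c2 = z2
  simp only [mul_comm, mul_left_comm, mul_assoc]

lemma pot_step {F : Type*} [Field F] {r : ℕ} (hr : 2 ≤ r) (k kr ur : Fˣ) {j : ℕ} (hj : j ≤ r)
    (z : E r) (h : 0 < alphaF r j z) :
    pot k kr ur (genF r j z) = ksj F r k kr ur j z * pot k kr ur z := by
  unfold pot
  by_cases h0 : j = 0
  · subst h0
    rw [alphaF, if_pos rfl, cd_eq z ⟨0, by omega⟩ 1 rfl] at h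
    rw [ksj, if_pos rfl]
    simp only [cd_eq z ⟨0, by omega⟩ 1 rfl]
    have e := iO_two_sub (v := 2 * z ⟨0, by omega⟩) (by linarith)
    have e' := iE_two_sub (2 * z ⟨0, by omega⟩)
    have hp : (∏ m : Fin r, (if 1 ≤ (m : ℕ) then
        k ^ (-eta (z ⟨0, by omega⟩ - z m) - eta (z ⟨0, by omega⟩ + z m)) else 1)) =
        k ^ (∑ m : Fin r, if 1 ≤ (m : ℕ) then
          (- eta (z ⟨0, by omega⟩ + z m) + - eta (z ⟨0, by omega⟩ - z m)) else 0) := by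
      rw [← prod_zpow']
      refine Finset.prod_congr rfl fun m _ => ?_
      split_ifs
      · congr 1; ring
      · rw [zpow_zero]
    rw [hp]
    apply comb3
    · rw [PS_zero _ _ z ⟨0, by omega⟩ rfl]
      simp only [iA_one_sub]
      ring
    · rw [PS_zero _ _ z ⟨0, by omega⟩ rfl, ← e']
      simp only [sub_self, add_zero, ite_self, Finset.sum_const_zero, mul_sub, mul_one]
      ring
    · rw [PS_zero _ _ z ⟨0, by omega⟩ rfl, ← e]
      simp only [sub_self, add_zero, ite_self, Finset.sum_const_zero, mul_sub, mul_one]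
      ring
  by_cases hjr : j = r
  · subst hjr
    rw [alphaF, if_neg h0, if_pos rfl] at h
    rw [ksj, if_neg h0, if_pos rfl]
    rw [cd_eq z ⟨j-1, by omega⟩ j (by simp; omega)] at h ⊢
    have e := iE_neg h
    have e' := iO_neg h
    rw [← mul_one (kr ^ _ * ur ^ _), ← zpow_zero k]
    apply comb3
    · rw [PS_last hr _ _ z ⟨j-1, by omega⟩ (by simp; omega)]; ring
    · rw [PS_last hr _ _ z ⟨j-1, by omega⟩ (by simp; omega), ← e, mul_neg]; ring
    · rw [PS_last hr _ _ z ⟨j-1, by omega⟩ (by simp; omega), ← e', mul_neg]; ring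
  · rw [alphaF, if_neg h0, if_neg hjr] at h
    rw [ksj, if_neg h0, if_neg hjr]
    rw [cd_eq z ⟨j-1, by omega⟩ j (by simp; omega), cd_eq z ⟨j, by omega⟩ (j+1) rfl] at h ⊢
    rw [← iA_neg h]
    have : ∀ g : Fˣ, g = kr ^ (0 : ℤ) * ur ^ (0 : ℤ) * g := fun g => by simp
    rw [this (k ^ (- iA _ + iA _))]
    apply comb3
    · rw [PS_mid _ _ z ⟨j-1, by omega⟩ ⟨j, by omega⟩ (by simp; omega) rfl]; ring
    · rw [PS_mid _ _ z ⟨j-1, by omega⟩ ⟨j, by omega⟩ (by simp; omega) rfl]; ring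
    · rw [PS_mid _ _ z ⟨j-1, by omega⟩ ⟨j, by omega⟩ (by simp; omega) rfl]; ring

lemma kword_nil {F : Type*} [Field F] {r : ℕ} (k kr ur : Fˣ) (z : E r) :
    kword F r k kr ur [] z = 1 := rfl

lemma kword_cons {F : Type*} [Field F] {r : ℕ} (k kr ur : Fˣ) (j : ℕ) (l : List ℕ) (z : E r) :
    kword F r k kr ur (j :: l) z = ksj F r k kr ur j (wordAct r l z) * kword F r k kr ur l z := by
  have : ∀ l : List ℕ, (l.foldr (fun j p => (genF r j p.1, ksj F r k kr ur j p.1 * p.2))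
      (z, (1 : Fˣ))).1 = wordAct r l z := by
    intro l
    induction l with
    | nil => rfl
    | cons j l ih => simp only [List.foldr_cons, wordAct_cons, ih]
  simp only [kword, List.foldr_cons, this]

lemma kword_pot {F : Type*} [Field F] {r : ℕ} (hr : 2 ≤ r) (k kr ur : Fˣ) {l : List ℕ} (hl : OKw r l)
    {c : E r} (ha : Asc r c l) :
    kword F r k kr ur l c * pot k kr ur c = pot k kr ur (wordAct r l c) := by
  induction l with
  | nil => rw [kword_nil, one_mul, wordAct_nil]
  | cons j l ih =>
    rw [kword_cons, wordAct_cons, pot_step hr k kr ur hl.head _ ha.1, ← ih hl.tail ha.2, mul_assoc]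

/-! ### Spans of monomials and truncated geometric series -/

/-- The span of the monomials with exponents in a given set. -/
def spn (F : Type*) [Field F] (r : ℕ) (S : E r → Prop) : Submodule F (QA F r) :=
  Submodule.span F {p | ∃ y, S y ∧ p = X F r y}

lemma X_mem {F : Type*} [Field F] {r : ℕ} {S : E r → Prop} {y : E r} (h : S y) :
    X F r y ∈ spn F r S := Submodule.subset_span ⟨y, h, rfl⟩

lemma spn_le {F : Type*} [Field F] {r : ℕ} {S : E r → Prop} {N : Submodule F (QA F r)}
    (h : ∀ y, S y → X F r y ∈ N) : spn F r S ≤ N := by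
  apply Submodule.span_le.2
  rintro p ⟨y, hy, rfl⟩
  exact h y hy

lemma spn_mono {F : Type*} [Field F] {r : ℕ} {S S' : E r → Prop} (h : ∀ y, S y → S' y) :
    spn F r S ≤ spn F r S' := spn_le fun y hy => X_mem (h y hy)

lemma X_mul {F : Type*} [Field F] {r : ℕ} (y z : E r) : X F r y * X F r z = X F r (y + z) := by
  simp [X, AddMonoidAlgebra.single_mul_single]

lemma mkOp_X {F : Type*} [Field F] {r : ℕ} (Ψ : E r → QA F r) (y : E r) :
    mkOp F r Ψ (X F r y) = Ψ y := by
  simp [mkOp, X]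

lemma geom_nat {F : Type*} [Field F] {r : ℕ} (v u : E r) (n : ℕ) :
    geomS F r 1 v (n : ℤ) * X F r u = ∑ t ∈ Finset.range n, X F r (u + (t : ℝ) • v) := by
  rw [geomS, if_pos (by positivity), Finset.sum_mul]
  refine Finset.sum_congr (by simp) fun t _ => ?_
  rw [one_zpow, one_smul, X_mul, add_comm]

lemma geom_neg_nat {F : Type*} [Field F] {r : ℕ} (v u : E r) (n : ℕ) :
    geomS F r 1 v (-(n : ℤ)) * X F r u
      = -∑ t ∈ Finset.range n, X F r (u - ((t : ℝ) + 1) • v) := by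
  rcases Nat.eq_zero_or_pos n with rfl | hn
  · simp [geomS]
  · rw [geomS, if_neg (by omega), neg_mul, Finset.sum_mul]
    congr 1
    refine Finset.sum_congr (by simp) fun t _ => ?_
    rw [one_zpow, one_smul, X_mul]
    congr 1
    module

lemma floor_nonneg_nat {x : ℝ} (h : 0 ≤ x) : ∃ n : ℕ, ⌊x⌋ = n ∧ (n : ℝ) ≤ x ∧ x < n + 1 := by
  obtain ⟨n, hn⟩ := Int.eq_ofNat_of_zero_le (Int.floor_nonneg.2 h)
  refine ⟨n, hn, ?_, ?_⟩
  · have := Int.floor_le x; rw [hn] at this; exact_mod_cast this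
  · have := Int.lt_floor_add_one x; rw [hn] at this; exact_mod_cast this

lemma floor_neg_nat {x : ℝ} (h : x < 0) : ∃ n : ℕ, ⌊x⌋ = -((n + 1 : ℕ) : ℤ) ∧ x < -n := by
  have h0 : ⌊x⌋ < 0 := Int.floor_lt.2 (by exact_mod_cast h)
  obtain ⟨n, hn⟩ := Int.eq_ofNat_of_zero_le (show 0 ≤ -⌊x⌋ - 1 by omega)
  have e : ⌊x⌋ = -((n + 1 : ℕ) : ℤ) := by push_cast; omega
  refine ⟨n, e, ?_⟩
  have := Int.lt_floor_add_one x
  rw [e] at this; push_cast at this; linarith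

lemma geomE {F : Type*} [Field F] {r : ℕ} (v u : E r) (x : ℝ) :
    geomS F r 1 v (-⌊x⌋) * X F r u - X F r u +
      (if (∃ n : ℤ, x = n) ∧ 0 ≤ x then (1 : F) else 0) • X F r (u - x • v) ∈
    spn F r (fun y => ∃ m : ℤ, ((0 ≤ m ∧ (m : ℝ) < x) ∨ (m ≤ -1 ∧ x < m)) ∧
      y = u - (m : ℝ) • v) := by
  rcases lt_or_ge x 0 with h | h
  · obtain ⟨n, hn, hx⟩ := floor_neg_nat h
    rw [if_neg (by intro h'; linarith [h'.2]), zero_smul, add_zero, hn, neg_neg, geom_nat,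
      Finset.sum_range_succ']
    simp only [Nat.cast_zero, zero_smul, add_zero, add_sub_cancel_right]
    refine Submodule.sum_mem _ fun t ht => X_mem ⟨-((t + 1 : ℕ) : ℤ), Or.inr ⟨by push_cast; omega, ?_⟩, ?_⟩
    · have : (t : ℝ) + 1 ≤ n := by exact_mod_cast Finset.mem_range.1 ht
      push_cast; linarith
    · push_cast; module
  · obtain ⟨n, hn, hx, hx'⟩ := floor_nonneg_nat h
    rw [hn, geom_neg_nat]
    have e : -∑ t ∈ Finset.range n, X F r (u - ((t : ℝ) + 1) • v) - X F r u =
        -∑ t ∈ Finset.range (n + 1), X F r (u - (t : ℝ) • v) := by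
      rw [Finset.sum_range_succ']
      simp only [Nat.cast_zero, zero_smul, sub_zero, Nat.cast_add, Nat.cast_one]
      abel
    rw [e]
    by_cases hi : ∃ m : ℤ, x = m
    · rw [if_pos ⟨hi, h⟩, one_smul]
      have hxn : x = n := by
        obtain ⟨m, rfl⟩ := hi
        rw [Int.floor_intCast] at hn
        rw [hn]; push_cast; rfl
      rw [Finset.sum_range_succ, hxn, neg_add, add_assoc, neg_add_cancel, add_zero]
      refine Submodule.neg_mem _ (Submodule.sum_mem _ fun t ht =>
        X_mem ⟨t, Or.inl ⟨by positivity, ?_⟩, by push_cast; rfl⟩)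
      have := Finset.mem_range.1 ht
      exact_mod_cast this
    · rw [if_neg (fun h' => hi h'.1), zero_smul, add_zero]
      refine Submodule.neg_mem _ (Submodule.sum_mem _ fun t ht =>
        X_mem ⟨t, Or.inl ⟨by positivity, ?_⟩, by push_cast; rfl⟩)
      have h1 : (t : ℝ) ≤ n := by exact_mod_cast Nat.lt_succ_iff.1 (Finset.mem_range.1 ht)
      have h2 : (n : ℝ) ≠ x := fun h' => hi ⟨n, by push_cast; exact h'.symm⟩
      have h3 : (n : ℝ) < x := lt_of_le_of_ne hx h2
      push_cast; linarith

lemma geomO {F : Type*} [Field F] {r : ℕ} (v u : E r) (x : ℝ) :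
    geomS F r 1 v (-⌊x⌋) * X F r u +
      (if (∃ n : ℤ, x = n) ∧ 1 ≤ x then (1 : F) else 0) • X F r (u - x • v) ∈
    spn F r (fun y => ∃ m : ℤ, ((1 ≤ m ∧ (m : ℝ) < x) ∨ (m ≤ 0 ∧ x < m)) ∧
      y = u - (m : ℝ) • v) := by
  rcases lt_or_ge x 0 with h | h
  · obtain ⟨n, hn, hx⟩ := floor_neg_nat h
    rw [if_neg (by intro h'; linarith [h'.2]), zero_smul, add_zero, hn, neg_neg, geom_nat]
    refine Submodule.sum_mem _ fun t ht => X_mem ⟨-(t : ℤ), Or.inr ⟨by omega, ?_⟩, ?_⟩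
    · have : (t : ℝ) ≤ n := by exact_mod_cast Nat.lt_succ_iff.1 (Finset.mem_range.1 ht)
      push_cast; linarith
    · push_cast; module
  · obtain ⟨n, hn, hx, hx'⟩ := floor_nonneg_nat h
    rw [hn, geom_neg_nat]
    by_cases hi : (∃ m : ℤ, x = m) ∧ 1 ≤ x
    · rw [if_pos hi, one_smul]
      have hxn : x = n := by
        obtain ⟨⟨m, rfl⟩, -⟩ := hi
        rw [Int.floor_intCast] at hn
        rw [hn]; push_cast; rfl
      have h1 : 1 ≤ n := by have := hi.2; rw [hxn] at this; exact_mod_cast this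
      obtain ⟨n, rfl⟩ : ∃ k, n = k + 1 := ⟨n - 1, by omega⟩
      rw [Finset.sum_range_succ, hxn, neg_add, add_assoc]
      push_cast
      rw [neg_add_cancel, add_zero]
      refine Submodule.neg_mem _ (Submodule.sum_mem _ fun t ht =>
        X_mem ⟨t + 1, Or.inl ⟨by omega, ?_⟩, by push_cast; rfl⟩)
      have : (t : ℝ) < n := by exact_mod_cast Finset.mem_range.1 ht
      push_cast; linarith
    · rw [if_neg hi, zero_smul, add_zero]
      refine Submodule.neg_mem _ (Submodule.sum_mem _ fun t ht =>
        X_mem ⟨t + 1, Or.inl ⟨by omega, ?_⟩, by push_cast; rfl⟩)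
      have h0 := Finset.mem_range.1 ht
      have h1 : (t : ℝ) + 1 ≤ n := by exact_mod_cast h0
      have h2 : (n : ℝ) ≠ x := fun h' => hi ⟨⟨n, by push_cast; exact h'.symm⟩, by
        have : (0 : ℝ) ≤ t := by positivity
        linarith⟩
      have h3 : (n : ℝ) < x := lt_of_le_of_ne hx h2
      push_cast; linarith

/-! ### The string below a reflected point -/

/-- Shift the constant term of a root. -/
def Rt.shift {r : ℕ} (a : Rt r) (m : ℤ) : Rt r := { a with n := a.n + m }

lemma Rt.ev_shift {r : ℕ} (a : Rt r) (m : ℤ) (y : E r) : (a.shift m).ev y = a.ev y + m := by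
  simp only [Rt.ev, Rt.shift]; push_cast; ring

lemma Rt.shift_comp {r : ℕ} (a : Rt r) (m : ℤ) (g : SP r) :
    (a.shift m).comp g = (a.comp g).shift m := by
  simp only [Rt.shift, Rt.comp, Rt.mk.injEq, true_and]
  ring

/-- Points in the open root string of `u` in direction `a`. -/
def Dn {r : ℕ} (a : Rt r) (u u' : E r) : Prop :=
  ∃ m : ℤ, ((0 ≤ m ∧ a.ev u + m < 0) ∨ (m ≤ -1 ∧ 0 < a.ev u + m)) ∧ u' = (a.shift m).rf u

lemma Dn_stp {r : ℕ} (a : Rt r) (h0 : 0 < a.ev (rho r)) (h1 : a.ev (rho r) < 1) {u u' : E r}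
    (h : Dn a u u') : stp r u' u := by
  obtain ⟨m, ⟨hm, hv⟩ | ⟨hm, hv⟩, rfl⟩ := h
  · refine ⟨a.shift m, ?_, ?_, rfl⟩
    · rw [Rt.ev_shift]
      have : (0 : ℝ) ≤ m := by exact_mod_cast hm
      linarith
    · rw [Rt.ev_shift]; exact hv
  · refine ⟨(a.shift m).neg, ?_, ?_, by rw [Rt.rf_neg]⟩
    · rw [Rt.ev_neg, Rt.ev_shift]
      have : (m : ℝ) ≤ -1 := by exact_mod_cast hm
      linarith
    · rw [Rt.ev_neg, Rt.ev_shift]; linarith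

lemma Dn_act {r : ℕ} (a : Rt r) (g : SP r) {u u'' : E r} (h : Dn a (g.act u) u'') :
    ∃ u', Dn (a.comp g) u u' ∧ u'' = g.act u' := by
  obtain ⟨m, hm, rfl⟩ := h
  refine ⟨((a.comp g).shift m).rf u, ⟨m, by rwa [Rt.ev_comp], rfl⟩, ?_⟩
  rw [Rt.rf_act, Rt.shift_comp]

/-- The root of index `j ≥ 1` and its constant-free shape. -/
lemma exRootFin {r : ℕ} (hr : 2 ≤ r) {j : ℕ} (hj : j ≤ r) (h0 : j ≠ 0) :
    ∃ a : Rt r, (∀ y, a.ev y = alphaF r j y) ∧ ∀ y (m : ℤ), (a.shift m).rf (genF r j y) =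
      y - (m : ℝ) • (if j = r then epsV r r else epsV r j - epsV r (j + 1)) := by
  obtain ⟨a, h1, h2⟩ := exRoot hr hj
  refine ⟨a, h1, fun y m => ?_⟩
  have key : (a.shift m).rf (genF r j y) = fun i => y i - (m : ℝ) * a.co i := by
    funext i
    have e1 : (a.shift m).rf (genF r j y) i = genF r j y i - (a.ev (genF r j y) + m) * a.co i := by
      rw [← Rt.ev_shift]; rfl
    rw [e1, ← h2, Rt.ev_rf]
    simp only [Rt.rf]; ring
  have hco : a.co = if j = r then epsV r r else epsV r j - epsV r (j + 1) := by
    -- read the coroot off from `rf` at a suitable point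
    funext i
    have hz : ∃ y, alphaF r j y = 1 ∧ y - genF r j y =
        (if j = r then epsV r r else epsV r j - epsV r (j + 1)) := by
      by_cases hjr : j = r
      · subst hjr
        refine ⟨fun _ => 1/2, ?_, ?_⟩
        · rw [alphaF, if_neg h0, if_pos rfl, cd_eq _ ⟨j-1, by omega⟩ j (by simp; omega)]; norm_num
        · funext m
          simp only [Pi.sub_apply, genF_last hr, if_true, epsV]
          split_ifs <;> norm_num
      · refine ⟨fun m => if (m : ℕ) + 1 = j then 1 else 0, ?_, ?_⟩
        · rw [alphaF, if_neg h0, if_neg hjr, cd_eq _ ⟨j-1, by omega⟩ j (by simp; omega),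
            cd_eq _ ⟨j, by omega⟩ (j+1) rfl]
          simp only
          rw [if_pos (by omega), if_neg (by omega)]; norm_num
        · funext m
          simp only [Pi.sub_apply, genF_mid h0 (show j - 1 < r by omega) (show j < r by omega),
            if_neg hjr, epsV]
          split_ifs <;> first | omega | norm_num
    obtain ⟨y, e1, e2⟩ := hz
    rw [← e2, ← h2]
    simp [Rt.rf, h1, e1]
  rw [key, hco]
  rfl

/-! ### Leading terms of the inverse Demazure–Lusztig operators -/

lemma chiZ_int (n : ℤ) : chiZ (n : ℝ) = 1 := by rw [chiZ, if_pos ⟨n, rfl⟩]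
lemma chiZ_not {z : ℝ} (h : ¬ ∃ n : ℤ, z = n) : chiZ z = 0 := by rw [chiZ, if_neg h]
lemma chiE_even (n : ℤ) : chiE (2 * n : ℝ) = 1 := by rw [chiE, if_pos ⟨n, rfl⟩]
lemma chiO_odd (n : ℤ) : chiO (2 * n + 1 : ℝ) = 1 := by rw [chiO, if_pos ⟨n, rfl⟩]
lemma chiE_odd (n : ℤ) : chiE (2 * n + 1 : ℝ) = 0 := by
  rw [chiE, if_neg]
  rintro ⟨m, h⟩
  have : (2 * n + 1 : ℤ) = 2 * m := by exact_mod_cast h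
  omega
lemma chiO_even (n : ℤ) : chiO (2 * n : ℝ) = 0 := by
  rw [chiO, if_neg]
  rintro ⟨m, h⟩
  have : (2 * n : ℤ) = 2 * m + 1 := by exact_mod_cast h
  omega
lemma chiE_not {z : ℝ} (h : ¬ ∃ n : ℤ, z = n) : chiE z = 0 := by
  rw [chiE, if_neg]
  rintro ⟨m, rfl⟩
  exact h ⟨2 * m, by push_cast; rfl⟩
lemma chiO_not {z : ℝ} (h : ¬ ∃ n : ℤ, z = n) : chiO z = 0 := by
  rw [chiO, if_neg]
  rintro ⟨m, rfl⟩
  exact h ⟨2 * m + 1, by push_cast; rfl⟩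

/-- The leading coefficient of `T_j⁻¹` on `x^u`. -/
def kap {F : Type*} [Field F] {r : ℕ} (k kr ur : Fˣ) (j : ℕ) (u : E r) : Fˣ :=
  if j = r then kr ^ (-etaE (2 * cd r u r + 2)) * ur ^ (-etaO (2 * cd r u r))
  else k ^ (-eta (cd r u j - cd r u (j + 1) + 1))

lemma scal_mid {F : Type*} [Field F] (k : Fˣ) (a : ℝ) :
    ((k ^ (-eta (a + 1)) : Fˣ) : F) =
      (k : F) ^ chiZ a - ((k : F) - (k : F)⁻¹) * (if (∃ n : ℤ, a = n) ∧ 0 ≤ a then (1 : F) else 0) := by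
  by_cases h : ∃ n : ℤ, a = n
  · obtain ⟨n, rfl⟩ := h
    have e : ((∃ m : ℤ, (n : ℝ) = m) ∧ 0 ≤ (n : ℝ)) ↔ 0 ≤ n := by
      constructor
      · rintro ⟨-, h⟩; exact_mod_cast h
      · intro h; exact ⟨⟨n, rfl⟩, by exact_mod_cast h⟩
    rw [show (n : ℝ) + 1 = ((n + 1 : ℤ) : ℝ) by push_cast; ring, eta_int, chiZ_int]
    simp only [e]
    by_cases hn : 0 ≤ n
    · rw [if_pos (by omega), if_pos hn]; simp
    · rw [if_neg (by omega), if_neg hn]; simp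
  · rw [eta_not (fun ⟨n, hn⟩ => h ⟨n - 1, by push_cast; linarith⟩), chiZ_not h,
      if_neg (fun h' => h h'.1)]
    simp

lemma scal_last {F : Type*} [Field F] (kr ur : Fˣ) (a : ℝ) :
    ((kr ^ (-etaE (a + 2)) * ur ^ (-etaO a) : Fˣ) : F) =
      (kr : F) ^ chiE a * (ur : F) ^ chiO a
        - ((kr : F) - (kr : F)⁻¹) * (if (∃ n : ℤ, a / 2 = n) ∧ 0 ≤ a / 2 then (1 : F) else 0)
        - ((ur : F) - (ur : F)⁻¹) *
          (if (∃ n : ℤ, (a + 1) / 2 = n) ∧ 1 ≤ (a + 1) / 2 then (1 : F) else 0) := by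
  rcases real_cases a with ⟨n, rfl⟩ | ⟨n, rfl⟩ | h
  · rw [show 2 * (n : ℝ) + 2 = 2 * ((n + 1 : ℤ) : ℝ) by push_cast; ring, etaE_even, etaO_even,
      chiE_even, chiO_even]
    have e1 : ((∃ m : ℤ, 2 * (n : ℝ) / 2 = m) ∧ 0 ≤ 2 * (n : ℝ) / 2) ↔ 0 ≤ n := by
      rw [mul_div_cancel_left₀ _ (two_ne_zero)]
      constructor
      · rintro ⟨-, h⟩; exact_mod_cast h
      · intro h; exact ⟨⟨n, rfl⟩, by exact_mod_cast h⟩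
    have e2 : ¬ ((∃ m : ℤ, (2 * (n : ℝ) + 1) / 2 = m) ∧ 1 ≤ (2 * (n : ℝ) + 1) / 2) := by
      rintro ⟨⟨m, h⟩, -⟩
      have : (2 * n + 1 : ℝ) = 2 * m := by linarith
      have : (2 * n + 1 : ℤ) = 2 * m := by exact_mod_cast this
      omega
    rw [if_neg e2]
    simp only [e1]
    by_cases hn : 0 ≤ n
    · rw [if_pos (by omega), if_pos hn]; simp
    · rw [if_neg (by omega), if_neg hn]; simp
  · rw [show 2 * (n : ℝ) + 1 + 2 = 2 * ((n + 1 : ℤ) : ℝ) + 1 by push_cast; ring, etaE_odd, etaO_odd,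
      chiE_odd, chiO_odd]
    have e1 : ((∃ m : ℤ, (2 * (n : ℝ) + 1 + 1) / 2 = m) ∧ 1 ≤ (2 * (n : ℝ) + 1 + 1) / 2) ↔ 0 ≤ n := by
      rw [show (2 * (n : ℝ) + 1 + 1) / 2 = ((n + 1 : ℤ) : ℝ) by push_cast; ring]
      constructor
      · rintro ⟨-, h⟩
        have : 1 ≤ n + 1 := by exact_mod_cast h
        omega
      · intro h
        have : 1 ≤ n + 1 := by omega
        exact ⟨⟨_, rfl⟩, by exact_mod_cast this⟩
    have e2 : ¬ ((∃ m : ℤ, (2 * (n : ℝ) + 1) / 2 = m) ∧ 0 ≤ (2 * (n : ℝ) + 1) / 2) := by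
      rintro ⟨⟨m, h⟩, -⟩
      have : (2 * n + 1 : ℝ) = 2 * m := by linarith
      have : (2 * n + 1 : ℤ) = 2 * m := by exact_mod_cast this
      omega
    rw [if_neg e2]
    simp only [e1]
    by_cases hn : 0 ≤ n
    · rw [if_pos (by omega), if_pos hn]; simp
    · rw [if_neg (by omega), if_neg hn]; simp
  · rw [etaE_not (fun ⟨n, hn⟩ => h ⟨n - 2, by push_cast; linarith⟩), etaO_not h, chiE_not h,
      chiO_not h, if_neg (fun ⟨⟨n, hn⟩, _⟩ => h ⟨2 * n, by push_cast; linarith⟩),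
      if_neg (fun ⟨⟨n, hn⟩, _⟩ => h ⟨2 * n - 1, by push_cast; linarith⟩)]
    simp

lemma genF_dir {r : ℕ} (hr : 2 ≤ r) {j : ℕ} (hj : j ≤ r) (h0 : j ≠ 0) (u : E r) :
    genF r j u = u - alphaF r j u • (if j = r then epsV r r else epsV r j - epsV r (j + 1)) := by
  by_cases hjr : j = r
  · subst hjr
    funext m
    rw [if_pos rfl, alphaF, if_neg h0, if_pos rfl, genF_last hr]
    simp only [Pi.sub_apply, Pi.smul_apply, epsV, smul_eq_mul]
    split_ifs with h
    · rw [cd_eq u m j h.symm]; ring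
    · ring
  · funext m
    rw [if_neg hjr, alphaF, if_neg h0, if_neg hjr,
      genF_mid h0 (show j - 1 < r by omega) (show j < r by omega)]
    simp only [Pi.sub_apply, Pi.smul_apply, epsV, smul_eq_mul]
    rw [cd_eq u ⟨j-1, by omega⟩ j (by simp; omega), cd_eq u ⟨j, by omega⟩ (j+1) rfl]
    split_ifs with h1 h2 h2
    · omega
    · rw [show m = ⟨j-1, by omega⟩ from Fin.ext (by simp; omega)]; ring
    · rw [show m = ⟨j, by omega⟩ from Fin.ext (by simp; omega)]; ring
    · omega
    · omega
    · ring

lemma TfullInv_X {F : Type*} [Field F] {r : ℕ} (qh : Fˣ) (k0 u0 k kr ur : F) (t : Fin r → Fˣ)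
    {j : ℕ} (h0 : j ≠ 0) (u : E r) :
    TfullInv F r qh k0 u0 k kr ur t j (X F r u) = Tel F r k kr ur j u -
      (if j = r then kr - kr⁻¹ else k - k⁻¹) • X F r u := by
  rw [TfullInv, LinearMap.sub_apply, LinearMap.smul_apply, Tfull, if_neg h0, Top, mkOp_X, kpar,
    if_neg h0]
  split_ifs <;> rfl

lemma TInv_lead {F : Type*} [Field F] {r : ℕ} (hr : 2 ≤ r) (qh : Fˣ) (k0 u0 : F) (k kr ur : Fˣ)
    (t : Fin r → Fˣ) {j : ℕ} (hj : j ≤ r) (h0 : j ≠ 0) :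
    ∃ a : Rt r, (∀ y, a.ev y = alphaF r j y) ∧ ∀ u : E r,
      TfullInv F r qh k0 u0 k kr ur t j (X F r u) -
        ((kap k kr ur j u : Fˣ) : F) • X F r (genF r j u) ∈ spn F r (Dn a (genF r j u)) := by
  obtain ⟨a, h1, h2⟩ := exRootFin hr hj h0
  refine ⟨a, h1, fun u => ?_⟩
  rw [TfullInv_X _ _ _ _ _ _ _ h0]
  have hD : ∀ m : ℤ, ((0 ≤ m ∧ (m : ℝ) < alphaF r j u) ∨ (m ≤ -1 ∧ alphaF r j u < m)) →
      Dn a (genF r j u)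
        (u - (m : ℝ) • (if j = r then epsV r r else epsV r j - epsV r (j + 1))) := by
    intro m hm
    refine ⟨m, ?_, (h2 u m).symm⟩
    rw [h1, alphaF_genF hr hj]
    rcases hm with ⟨m1, m2⟩ | ⟨m1, m2⟩
    · exact Or.inl ⟨m1, by linarith⟩
    · exact Or.inr ⟨m1, by linarith⟩
  have hdir := genF_dir hr hj h0 u
  by_cases hjr : j = r
  · subst hjr
    simp only [if_true] at hD hdir ⊢
    rw [Tel, if_pos rfl, kap, if_pos rfl]
    have hs : sW j j u = genF j j u := by rw [genF, if_neg h0]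
    rw [hs, scal_last, nablaReEl, nablaRoEl]
    have ha : alphaF j j u = 2 * cd j u j := by rw [alphaF, if_neg h0, if_pos rfl]
    rw [← ha]
    rw [ha] at hD hdir
    rw [ha]
    generalize 2 * cd j u j = x at *
    have e1 : -floorE x / 2 = -⌊x / 2⌋ := by unfold floorE; omega
    have e2 : (-floorO x - 1) / 2 = -⌊(x + 1) / 2⌋ := by unfold floorO; omega
    rw [e1, e2]
    have e3 : X F j (epsV j j) * geomS F j 1 ((2 : ℝ) • epsV j j) (-⌊(x + 1) / 2⌋) * X F j u =
        geomS F j 1 ((2 : ℝ) • epsV j j) (-⌊(x + 1) / 2⌋) * X F j (u + epsV j j) := by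
      rw [mul_comm (X F j (epsV j j)), mul_assoc, X_mul, add_comm u]
    rw [e3]
    have g1 := geomE (F := F) ((2 : ℝ) • epsV j j) u (x / 2)
    have g2 := geomO (F := F) ((2 : ℝ) • epsV j j) (u + epsV j j) ((x + 1) / 2)
    have f1 : u - (x / 2) • ((2 : ℝ) • epsV j j) = genF j j u := by rw [hdir]; module
    have f2 : u + epsV j j - ((x + 1) / 2) • ((2 : ℝ) • epsV j j) = genF j j u := by
      rw [hdir]; module
    rw [f1] at g1
    rw [f2] at g2
    have m1 := spn_mono (S' := Dn a (genF j j u)) (by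
      rintro y ⟨m, hm, rfl⟩
      rw [show u - (m : ℝ) • ((2 : ℝ) • epsV j j) = u - ((2 * m : ℤ) : ℝ) • epsV j j by
        push_cast; module]
      apply hD
      push_cast
      rcases hm with ⟨p, q⟩ | ⟨p, q⟩
      · exact Or.inl ⟨by omega, by linarith⟩
      · exact Or.inr ⟨by omega, by linarith⟩) g1
    have m2 := spn_mono (S' := Dn a (genF j j u)) (by
      rintro y ⟨m, hm, rfl⟩
      rw [show u + epsV j j - (m : ℝ) • ((2 : ℝ) • epsV j j) =
          u - ((2 * m - 1 : ℤ) : ℝ) • epsV j j by push_cast; module]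
      apply hD
      push_cast
      rcases hm with ⟨p, q⟩ | ⟨p, q⟩
      · exact Or.inl ⟨by omega, by linarith⟩
      · exact Or.inr ⟨by omega, by linarith⟩) g2
    have := Submodule.add_mem _ (Submodule.smul_mem _ ((kr : F) - (kr : F)⁻¹) m1)
      (Submodule.smul_mem _ ((ur : F) - (ur : F)⁻¹) m2)
    convert this using 1
    module
  · simp only [if_neg hjr] at hD hdir ⊢
    rw [Tel, if_neg hjr, kap, if_neg hjr]
    have hs : sW r j u = genF r j u := by rw [genF, if_neg h0]
    rw [hs, scal_mid, nablaIel]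
    have ha : alphaF r j u = cd r u j - cd r u (j + 1) := by rw [alphaF, if_neg h0, if_neg hjr]
    rw [ha] at hD hdir
    generalize cd r u j - cd r u (j + 1) = x at *
    have g1 := geomE (F := F) (epsV r j - epsV r (j + 1)) u x
    rw [← hdir] at g1
    have m1 := spn_mono (S' := Dn a (genF r j u)) (by
      rintro y ⟨m, hm, rfl⟩
      exact hD m hm) g1
    have := Submodule.smul_mem _ ((k : F) - (k : F)⁻¹) m1
    convert this using 1
    module

/-! ### Propagation of triangularity -/

/-- `f` has leading term `κ x^{g w}`, the other terms being `x^{g w'}` with `w' < w`. -/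
def Inv {F : Type*} [Field F] {r : ℕ} (g : SP r) (w : E r) (f : QA F r) (κ : Fˣ) : Prop :=
  f - (κ : F) • X F r (g.act w) ∈ spn F r (fun y => ∃ w', lt' r w' w ∧ y = g.act w')

lemma inv_step {F : Type*} [Field F] {r : ℕ} (hr : 2 ≤ r) (qh : Fˣ) (k0 u0 : F) (k kr ur : Fˣ)
    (t : Fin r → Fˣ) {j : ℕ} (hj : j ≤ r) (h0 : j ≠ 0) {g g' : SP r}
    (hg : ∀ y, genF r j (g.act y) = g'.act y) (hp : 0 < alphaF r j (g'.act (rho r)))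
    (hp' : alphaF r j (g'.act (rho r)) < 1) {w : E r} {f : QA F r} {κ : Fˣ} (h : Inv g w f κ) :
    Inv g' w (TfullInv F r qh k0 u0 k kr ur t j f) (κ * kap k kr ur j (g.act w)) := by
  obtain ⟨a, h1, h2⟩ := TInv_lead hr qh k0 u0 k kr ur t hj h0
  set T := TfullInv F r qh k0 u0 k kr ur t j
  have key : ∀ w' : E r, T (X F r (g.act w')) - ((kap k kr ur j (g.act w') : Fˣ) : F) •
      X F r (g'.act w') ∈ spn F r (fun y => ∃ v, stp r v w' ∧ y = g'.act v) := by
    intro w'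
    have := h2 (g.act w')
    rw [hg] at this
    refine spn_mono ?_ this
    intro y hy
    obtain ⟨v, v1, v2⟩ := Dn_act a g' hy
    refine ⟨v, Dn_stp (a.comp g') ?_ ?_ v1, v2⟩
    · rw [Rt.ev_comp, h1]; exact hp
    · rw [Rt.ev_comp, h1]; exact hp'
  have e : T f - ((κ * kap k kr ur j (g.act w) : Fˣ) : F) • X F r (g'.act w) =
      T (f - (κ : F) • X F r (g.act w)) + (κ : F) • (T (X F r (g.act w)) -
        ((kap k kr ur j (g.act w) : Fˣ) : F) • X F r (g'.act w)) := by
    rw [map_sub, map_smul, Units.val_mul]; module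
  unfold Inv
  rw [e]
  refine Submodule.add_mem _ ?_ (Submodule.smul_mem _ _ (spn_mono ?_ (key w)))
  · have hle : spn F r (fun y => ∃ w', lt' r w' w ∧ y = g.act w') ≤
        (spn F r (fun y => ∃ w', lt' r w' w ∧ y = g'.act w')).comap T := by
      apply spn_le
      rintro y ⟨w', hw, rfl⟩
      rw [Submodule.mem_comap]
      have := Submodule.add_mem _ (spn_mono (S' := fun y => ∃ w', lt' r w' w ∧ y = g'.act w')
        (by
          rintro y ⟨v, hv, rfl⟩
          exact ⟨v, Relation.TransGen.head hv hw, rfl⟩) (key w'))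
        (Submodule.smul_mem _ ((kap k kr ur j (g.act w') : Fˣ) : F)
          (X_mem (F := F) ⟨w', hw, rfl⟩))
      rwa [sub_add_cancel] at this
    exact hle h
  · rintro y ⟨v, hv, rfl⟩
    exact ⟨v, Relation.TransGen.single hv, rfl⟩

/-- Move coordinate `0` into position `n` with sign `s`. -/
def qm {r : ℕ} (s : ℤ) (hs : s = 1 ∨ s = -1) (n : ℕ) (hn : n < r) : SP r where
  p := fun m => if h : (m : ℕ) < n then ⟨m + 1, by omega⟩
    else if (m : ℕ) = n then ⟨0, by omega⟩ else m
  inj := by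
    intro a b h
    apply Fin.ext
    have h' := congrArg Fin.val h
    simp only at h'
    split_ifs at h' <;> (try simp at h') <;> omega
  sg := fun m => if (m : ℕ) = n then s else 1
  hsg := by intro m; split_ifs <;> simp [hs]
  off := fun _ => 0

lemma qm_lt {r : ℕ} (s : ℤ) (hs : s = 1 ∨ s = -1) (n : ℕ) (hn : n < r) (y : E r) (m m' : Fin r)
    (h : (m : ℕ) < n) (h' : (m' : ℕ) = m + 1) : (qm s hs n hn).act y m = y m' := by
  have : (⟨m + 1, by omega⟩ : Fin r) = m' := Fin.ext h'.symm
  simp [SP.act, qm, h, h.ne, this]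

lemma qm_eq {r : ℕ} (s : ℤ) (hs : s = 1 ∨ s = -1) (n : ℕ) (hn : n < r) (y : E r) (m m' : Fin r)
    (h : (m : ℕ) = n) (h' : (m' : ℕ) = 0) : (qm s hs n hn).act y m = s * y m' := by
  have : (⟨0, by omega⟩ : Fin r) = m' := Fin.ext h'.symm
  simp [SP.act, qm, h, this]

lemma qm_at {r : ℕ} (s : ℤ) (hs : s = 1 ∨ s = -1) (n : ℕ) (hn hn' : n < r) (y : E r) :
    (qm s hs n hn).act y ⟨n, hn'⟩ = s * y ⟨0, by omega⟩ :=
  qm_eq _ _ _ _ _ _ _ rfl rfl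

lemma qm_gt {r : ℕ} (s : ℤ) (hs : s = 1 ∨ s = -1) (n : ℕ) (hn : n < r) (y : E r) (m : Fin r)
    (h : n < (m : ℕ)) : (qm s hs n hn).act y m = y m := by
  simp [SP.act, qm, h.not_gt, h.ne']

lemma qm_swap {r : ℕ} (s : ℤ) (hs : s = 1 ∨ s = -1) (n : ℕ) (hn : n + 1 < r) (y : E r) :
    genF r (n + 1) ((qm s hs n (by omega)).act y) = (qm s hs (n + 1) hn).act y := by
  funext m
  rw [genF_mid (by omega) (show n + 1 - 1 < r by omega) hn]
  simp only [Nat.add_sub_cancel]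
  split_ifs with h1 h2
  · rw [qm_gt _ _ _ _ _ _ (by simp), qm_lt _ _ _ _ _ m ⟨n + 1, hn⟩ (by omega) (by simp; omega)]
  · rw [qm_at, qm_eq _ _ _ _ _ m ⟨0, by omega⟩ (by omega) rfl]
  · rcases lt_or_gt_of_ne (show (m : ℕ) ≠ n by omega) with h | h
    · rw [qm_lt _ _ _ _ _ m ⟨m + 1, by omega⟩ (by omega) rfl,
        qm_lt _ _ _ _ _ m ⟨m + 1, by omega⟩ (by omega) rfl]
    · rw [qm_gt _ _ _ _ _ _ (by omega), qm_gt _ _ _ _ _ _ (by omega)]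

lemma qm_last {r : ℕ} (hr : 2 ≤ r) (y : E r) :
    genF r r ((qm (-1) (Or.inr rfl) (r - 1) (by omega)).act y) =
      (qm 1 (Or.inl rfl) (r - 1) (by omega)).act y := by
  funext m
  rw [genF_last hr]
  split_ifs with h
  · rw [qm_eq _ _ _ _ _ m ⟨0, by omega⟩ (by omega) rfl, qm_eq _ _ _ _ _ m ⟨0, by omega⟩ (by omega) rfl]
    push_cast; ring
  · rw [qm_lt _ _ _ _ _ m ⟨m + 1, by omega⟩ (by omega) rfl,
        qm_lt _ _ _ _ _ m ⟨m + 1, by omega⟩ (by omega) rfl]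

lemma qm_one {r : ℕ} (hr : 2 ≤ r) (y : E r) : (qm 1 (Or.inl rfl) 0 (show 0 < r by omega)).act y = y := by
  funext m
  rcases Nat.eq_zero_or_pos (m : ℕ) with h | h
  · rw [qm_eq _ _ _ _ _ m m h h]; simp
  · rw [qm_gt _ _ _ _ _ _ h]

lemma qm_start {r : ℕ} (hr : 2 ≤ r) (z : E r) :
    (qm (-1) (Or.inr rfl) 0 (show 0 < r by omega)).act (genF r 0 z) = (-1 : ℝ) • epsV r 1 + z := by
  funext m
  rcases Nat.eq_zero_or_pos (m : ℕ) with h | h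
  · rw [qm_eq _ _ _ _ _ m m h h, genF_zero]; simp [epsV, h]; ring
  · rw [qm_gt _ _ _ _ _ _ h, genF_zero]; simp [epsV, h.ne']

lemma rho_pos {r : ℕ} (m : Fin r) : 0 < rho r m := by
  have : (m : ℝ) < r := by exact_mod_cast m.2
  unfold rho
  apply div_pos <;> [linarith; positivity]

lemma rho_half {r : ℕ} (m : Fin r) : rho r m < 1 / 2 := by
  unfold rho
  rw [div_lt_div_iff₀ (by positivity) (by norm_num)]
  have : (0 : ℝ) ≤ m := by positivity
  linarith

lemma rho_anti {r : ℕ} {m n : Fin r} (h : (m : ℕ) < n) : rho r n < rho r m := by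
  have : (m : ℝ) < n := by exact_mod_cast h
  unfold rho
  gcongr

/-- The first pass. -/
lemma pass_one {F : Type*} [Field F] {r : ℕ} (hr : 2 ≤ r) (qh : Fˣ) (k0 u0 : F) (k kr ur : Fˣ)
    (t : Fin r → Fˣ) (z : E r) (n : ℕ) (hn : n < r) :
    Inv (qm (-1) (Or.inr rfl) n hn) (genF r 0 z)
      (((((List.range n).map (· + 1)).reverse.map
        (TfullInv F r qh k0 u0 (k : F) (kr : F) (ur : F) t)).prod)
          (X F r ((-1 : ℝ) • epsV r 1 + z)))
      (∏ m ∈ Finset.range n, k ^ (-eta (cd r z 1 - cd r z (m + 2)))) := by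
  induction n with
  | zero =>
    unfold Inv
    rw [qm_start hr]
    simp
  | succ n ih =>
    have h := inv_step hr qh k0 u0 k kr ur t (j := n + 1) (by omega) (by omega)
      (g' := qm (-1) (Or.inr rfl) (n + 1) hn) (fun y => qm_swap _ _ _ hn y) ?_ ?_ (ih (by omega))
    · rw [List.range_succ, List.map_append, List.reverse_append, List.map_append, List.prod_append,
        Module.End.mul_apply, Finset.prod_range_succ]
      convert h using 1
      · simp
      · congr 1
        rw [kap, if_neg (by omega)]
        congr 3
        rw [cd_eq z ⟨0, by omega⟩ 1 rfl, cd_eq z ⟨n + 1, by omega⟩ (n + 2) rfl,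
          cd_eq _ ⟨n, by omega⟩ (n + 1) rfl, cd_eq _ ⟨n + 1, by omega⟩ (n + 1 + 1) rfl,
          qm_at, qm_gt _ _ _ _ _ _ (by simp),
          genF_zero, genF_zero]
        simp
        ring
    all_goals
      rw [alphaF, if_neg (by omega), if_neg (by omega), cd_eq _ ⟨n, by omega⟩ (n + 1) rfl,
        cd_eq _ ⟨n + 1, by omega⟩ (n + 1 + 1) rfl,
        qm_lt _ _ _ _ _ _ ⟨n + 1, by omega⟩ (by simp) rfl, qm_at]
      push_cast
      have h1 := rho_pos (⟨0, by omega⟩ : Fin r)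
      have h2 := rho_pos (⟨n + 1, by omega⟩ : Fin r)
      have h3 := rho_half (⟨0, by omega⟩ : Fin r)
      have h4 := rho_half (⟨n + 1, by omega⟩ : Fin r)
      linarith

/-- The second pass. -/
lemma pass_two {F : Type*} [Field F] {r : ℕ} (hr : 2 ≤ r) (qh : Fˣ) (k0 u0 : F) (k kr ur : Fˣ)
    (t : Fin r → Fˣ) (z : E r) (n : ℕ) (hn : n < r) {f : QA F r} {κ : Fˣ}
    (hf : Inv (qm 1 (Or.inl rfl) n hn) (genF r 0 z) f κ) :
    Inv (qm 1 (Or.inl rfl) 0 (by omega)) (genF r 0 z)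
      (((((List.range n).map (· + 1)).map
        (TfullInv F r qh k0 u0 (k : F) (kr : F) (ur : F) t)).prod) f)
      (κ * ∏ m ∈ Finset.range n, k ^ (-eta (cd r z 1 + cd r z (m + 2)))) := by
  induction n generalizing f κ with
  | zero => simpa using hf
  | succ n ih =>
    have h := inv_step hr qh k0 u0 k kr ur t (j := n + 1) (by omega) (by omega)
      (g' := qm 1 (Or.inl rfl) n (by omega))
      (fun y => by rw [← qm_swap _ _ _ hn y, genF_genF hr (by omega)]) ?_ ?_ hf
    · have h' := ih (by omega) h
      rw [List.range_succ, List.map_append, List.map_append, List.prod_append,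
        Module.End.mul_apply, Finset.prod_range_succ]
      convert h' using 1
      · simp
      · rw [mul_assoc κ, mul_comm (∏ m ∈ Finset.range n, _)]
        congr 2
        rw [kap, if_neg (by omega)]
        congr 3
        rw [cd_eq z ⟨0, by omega⟩ 1 rfl, cd_eq z ⟨n + 1, by omega⟩ (n + 2) rfl,
          cd_eq _ ⟨n, by omega⟩ (n + 1) rfl, cd_eq _ ⟨n + 1, by omega⟩ (n + 1 + 1) rfl,
          qm_lt _ _ _ _ _ _ ⟨n + 1, by omega⟩ (by simp) rfl, qm_at,
          genF_zero, genF_zero]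
        simp
        ring
    all_goals
      rw [alphaF, if_neg (by omega), if_neg (by omega), cd_eq _ ⟨n, by omega⟩ (n + 1) rfl,
        cd_eq _ ⟨n + 1, by omega⟩ (n + 1 + 1) rfl,
        qm_at, qm_gt _ _ _ _ _ _ (by simp)]
      push_cast
      have h1 := rho_anti (r := r) (m := ⟨0, by omega⟩) (n := ⟨n + 1, by omega⟩) (by simp)
      have h2 := rho_pos (⟨n + 1, by omega⟩ : Fin r)
      have h3 := rho_half (⟨0, by omega⟩ : Fin r)
      linarith

/-- The leading coefficient of `D₀`. -/
def kap0 {F : Type*} [Field F] {r : ℕ} (k kr ur : Fˣ) (z : E r) : Fˣ :=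
  (∏ m ∈ Finset.range (r - 1), k ^ (-eta (cd r z 1 - cd r z (m + 2)))) *
    (kr ^ (-etaE (2 * cd r z 1)) * ur ^ (-etaO (2 * cd r z 1 - 2))) *
    ∏ m ∈ Finset.range (r - 1), k ^ (-eta (cd r z 1 + cd r z (m + 2)))

lemma D0_lead {F : Type*} [Field F] {r : ℕ} (hr : 2 ≤ r) (qh : Fˣ) (k0 u0 : F) (k kr ur : Fˣ)
    (t : Fin r → Fˣ) (z : E r) :
    D0op F r qh k0 u0 k kr ur t (X F r z) - ((kap0 k kr ur z : Fˣ) : F) • X F r (genF r 0 z) ∈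
      spn F r (fun y => lt' r y (genF r 0 z)) := by
  have h1 := pass_one hr qh k0 u0 k kr ur t z (r - 1) (by omega)
  have h2 := inv_step hr qh k0 u0 k kr ur t (j := r) le_rfl (by omega)
      (g' := qm 1 (Or.inl rfl) (r - 1) (by omega)) (fun y => qm_last hr y) ?_ ?_ h1
  · have h3 := pass_two hr qh k0 u0 k kr ur t z (r - 1) (by omega) h2
    have hk : kap k kr ur r ((qm (-1) (Or.inr rfl) (r - 1) (by omega)).act (genF r 0 z)) =
        kr ^ (-etaE (2 * cd r z 1)) * ur ^ (-etaO (2 * cd r z 1 - 2)) := by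
      rw [kap, if_pos rfl, cd_eq _ ⟨r - 1, by omega⟩ r (by simp; omega),
        qm_at, genF_zero, cd_eq z ⟨0, by omega⟩ 1 rfl]
      simp only [if_true]
      congr 4 <;> push_cast <;> ring
    rw [hk] at h3
    unfold Inv at h3
    rw [qm_one hr] at h3
    simp only [qm_one hr] at h3
    have hD : D0op F r qh k0 u0 k kr ur t (X F r z) =
        ((((List.range (r - 1)).map (· + 1)).map
          (TfullInv F r qh k0 u0 (k : F) (kr : F) (ur : F) t)).prod)
        (TfullInv F r qh k0 u0 (k : F) (kr : F) (ur : F) t r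
        (((((List.range (r - 1)).map (· + 1)).reverse.map
          (TfullInv F r qh k0 u0 (k : F) (kr : F) (ur : F) t)).prod)
          (X F r ((-1 : ℝ) • epsV r 1 + z)))) := by
      rw [D0op, Module.End.mul_apply, Mop, mkOp_X, X_mul, palin, List.map_append, List.map_append,
        List.prod_append, List.prod_append, Module.End.mul_apply, Module.End.mul_apply]
      simp
    rw [hD]
    refine spn_mono ?_ h3
    rintro y ⟨w', hw, rfl⟩
    exact hw
  all_goals
    rw [alphaF, if_neg (by omega), if_pos rfl, cd_eq _ ⟨r - 1, by omega⟩ r (by simp; omega),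
      qm_at]
    push_cast
    have h1 := rho_pos (⟨0, by omega⟩ : Fin r)
    have h3 := rho_half (⟨0, by omega⟩ : Fin r)
    linarith

/-! ### Leading terms of the operators `D_j` -/

lemma etaO_shift {x : ℝ} (h : x < 1) : etaO (x - 2) = etaO x := by
  rcases real_cases x with ⟨n, rfl⟩ | ⟨n, rfl⟩ | h'
  · rw [show 2 * (n : ℝ) - 2 = 2 * ((n - 1 : ℤ) : ℝ) by push_cast; ring, etaO_even, etaO_even]
  · have hn : n < 0 := by
      have : (n : ℝ) < 0 := by linarith
      exact_mod_cast this
    rw [show 2 * (n : ℝ) + 1 - 2 = 2 * ((n - 1 : ℤ) : ℝ) + 1 by push_cast; ring, etaO_odd, etaO_odd,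
      if_neg (by omega), if_neg (by omega)]
  · rw [etaO_not h', etaO_not (fun ⟨n, hn⟩ => h' ⟨n + 2, by push_cast; linarith⟩)]

lemma etaE_shift {x : ℝ} (h : 0 < x) : etaE (x + 2) = etaE x := by
  rcases real_cases x with ⟨n, rfl⟩ | ⟨n, rfl⟩ | h'
  · have hn : 0 < n := by
      have : (0 : ℝ) < n := by linarith
      exact_mod_cast this
    rw [show 2 * (n : ℝ) + 2 = 2 * ((n + 1 : ℤ) : ℝ) by push_cast; ring, etaE_even, etaE_even,
      if_pos (by omega), if_pos (by omega)]
  · rw [show 2 * (n : ℝ) + 1 + 2 = 2 * ((n + 1 : ℤ) : ℝ) + 1 by push_cast; ring, etaE_odd, etaE_odd]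
  · rw [etaE_not h', etaE_not (fun ⟨n, hn⟩ => h' ⟨n - 2, by push_cast; linarith⟩)]

lemma eta_shift {x : ℝ} (h : 0 < x) : eta (x + 1) = eta x := by
  by_cases h' : ∃ n : ℤ, x = n
  · obtain ⟨n, rfl⟩ := h'
    have hn : 0 < n := by exact_mod_cast h
    rw [show (n : ℝ) + 1 = ((n + 1 : ℤ) : ℝ) by push_cast; ring, eta_int, eta_int,
      if_pos (by omega), if_pos (by omega)]
  · rw [eta_not h', eta_not (fun ⟨n, hn⟩ => h' ⟨n - 1, by push_cast; linarith⟩)]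

lemma kap0_prod {F : Type*} [Field F] {r : ℕ} (k kr ur : Fˣ) (z : E r) :
    kap0 k kr ur z = kr ^ (-etaE (2 * cd r z 1)) * ur ^ (-etaO (2 * cd r z 1 - 2)) *
      ∏ m ∈ Finset.range (r - 1),
        k ^ (-eta (cd r z 1 - cd r z (m + 2)) - eta (cd r z 1 + cd r z (m + 2))) := by
  have : ∀ m, k ^ (-eta (cd r z 1 - cd r z (m + 2)) - eta (cd r z 1 + cd r z (m + 2))) =
      k ^ (-eta (cd r z 1 - cd r z (m + 2))) * k ^ (-eta (cd r z 1 + cd r z (m + 2))) := by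
    intro m
    rw [sub_eq_add_neg, zpow_add]
  simp only [this]
  rw [Finset.prod_mul_distrib, kap0]
  rw [mul_comm (∏ m ∈ Finset.range (r - 1), k ^ (-eta (cd r z 1 - cd r z (m + 2)))), mul_assoc]

lemma kap0_ksj {F : Type*} [Field F] {r : ℕ} (hr : 2 ≤ r) (k kr ur : Fˣ) (z : E r)
    (h : 0 < alphaF r 0 z) : kap0 k kr ur z = ksj F r k kr ur 0 z := by
  rw [alphaF, if_pos rfl] at h
  rw [kap0_prod, ksj, if_pos rfl, etaO_shift (by linarith)]
  congr 1
  have e : ∀ m : Fin r, (if 1 ≤ (m : ℕ) then k ^ (-eta (cd r z 1 - z m) - eta (cd r z 1 + z m))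
      else 1) = (fun n : ℕ => if 1 ≤ n then
        k ^ (-eta (cd r z 1 - cd r z (n + 1)) - eta (cd r z 1 + cd r z (n + 1))) else 1) (m : ℕ) := by
    intro m
    simp only
    rw [cd_eq z m (m + 1) rfl]
  simp only [e]
  rw [Fin.prod_univ_eq_prod_range (fun n : ℕ => if 1 ≤ n then
        k ^ (-eta (cd r z 1 - cd r z (n + 1)) - eta (cd r z 1 + cd r z (n + 1))) else 1) r]
  obtain ⟨s, rfl⟩ : ∃ s, r = s + 1 := ⟨r - 1, by omega⟩
  rw [Finset.prod_range_succ']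
  simp

lemma kap0_c {F : Type*} [Field F] {r : ℕ} (hr : 2 ≤ r) (k kr ur : Fˣ) {c : E r}
    (hc : c ∈ CplusCl r) (h : alphaF r 0 c = 0) : kap0 k kr ur c = ur := by
  rw [alphaF, if_pos rfl] at h
  have h1 : cd r c 1 = 1 / 2 := by linarith
  rw [kap0_prod, h1, Finset.prod_eq_one]
  · rw [show (2 : ℝ) * (1 / 2) = 2 * ((0 : ℤ) : ℝ) + 1 by norm_num, etaE_odd,
      show 2 * ((0 : ℤ) : ℝ) + 1 - 2 = 2 * ((-1 : ℤ) : ℝ) + 1 by norm_num, etaO_odd, if_neg (by omega)]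
    simp
  · intro m hm
    have hm' : m + 1 < r := by have := Finset.mem_range.1 hm; omega
    rw [cd_eq c ⟨m + 1, hm'⟩ (m + 2) rfl]
    obtain ⟨l1, l2⟩ := hc.2 ⟨m + 1, hm'⟩
    generalize c ⟨m + 1, hm'⟩ = v at *
    rcases eq_or_lt_of_le l2 with rfl | l2
    · rw [show (1 / 2 - 1 / 2 : ℝ) = ((0 : ℤ) : ℝ) by norm_num, eta_int,
        show (1 / 2 + 1 / 2 : ℝ) = ((1 : ℤ) : ℝ) by norm_num, eta_int]
      simp
    · have no : ∀ x : ℝ, 0 < x → x < 1 → ¬ ∃ n : ℤ, x = n := by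
        rintro x x1 x2 ⟨n, rfl⟩
        have y1 : 0 < n := by exact_mod_cast x1
        have y2 : n < 1 := by exact_mod_cast x2
        omega
      rw [eta_not (no _ (by linarith) (by linarith)), eta_not (no _ (by linarith) (by linarith))]
      simp

/-- A simple reflection going up. -/
lemma lt_up {r : ℕ} (hr : 2 ≤ r) {j : ℕ} (hj : j ≤ r) {z : E r} (h : 0 < alphaF r j z) :
    lt' r z (genF r j z) := by
  obtain ⟨a, a0, a1, a2⟩ := exRootPos hr hj
  refine Relation.TransGen.single ⟨a, a0, ?_, ?_⟩
  · rw [a1, alphaF_genF hr hj]; linarith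
  · rw [a2, genF_genF hr hj]

lemma TInv_lt {F : Type*} [Field F] {r : ℕ} (hr : 2 ≤ r) (qh : Fˣ) (k0 u0 : F) (k kr ur : Fˣ)
    (t : Fin r → Fˣ) {j : ℕ} (hj : j ≤ r) (h0 : j ≠ 0) (u : E r) :
      TfullInv F r qh k0 u0 k kr ur t j (X F r u) -
        ((kap k kr ur j u : Fˣ) : F) • X F r (genF r j u) ∈
          spn F r (fun y => lt' r y (genF r j u)) := by
  obtain ⟨a, h1, h2⟩ := TInv_lead hr qh k0 u0 k kr ur t hj h0
  obtain ⟨b, b0, b1, -⟩ := exRootPos hr hj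
  refine spn_mono ?_ (h2 u)
  intro y hy
  refine Relation.TransGen.single (Dn_stp a ?_ ?_ hy)
  · rw [h1, ← b1]; exact b0
  · rw [h1, alphaF, if_neg h0]
    split_ifs with hjr
    · rw [cd_eq _ ⟨r - 1, by omega⟩ r (by simp; omega)]
      linarith [rho_half (⟨r - 1, by omega⟩ : Fin r)]
    · rw [cd_eq _ ⟨j - 1, by omega⟩ j (by simp; omega), cd_eq _ ⟨j, by omega⟩ (j + 1) rfl]
      linarith [rho_half (⟨j - 1, by omega⟩ : Fin r), rho_pos (⟨j, by omega⟩ : Fin r)]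

lemma Dop_X {F : Type*} [Field F] {r : ℕ} (qh : Fˣ) (k0 u0 k kr ur : F) (t : Fin r → Fˣ)
    {j : ℕ} (h0 : j ≠ 0) (u : E r) :
    Dop F r qh k0 u0 k kr ur t j (X F r u) = TfullInv F r qh k0 u0 k kr ur t j (X F r u) +
      (if j = r then kr - kr⁻¹ else k - k⁻¹) • X F r u := by
  rw [TfullInv_X _ _ _ _ _ _ _ h0, sub_add_cancel, Dop, if_neg h0, Tfull, if_neg h0, Top, mkOp_X]

lemma D_gen {F : Type*} [Field F] {r : ℕ} (hr : 2 ≤ r) (qh : Fˣ) (k0 u0 : F) (k kr ur : Fˣ)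
    (t : Fin r → Fˣ) {j : ℕ} (hj : j ≤ r) (z : E r) :
    Dop F r qh k0 u0 k kr ur t j (X F r z) ∈
      spn F r (fun y => y = z ∨ y = genF r j z ∨ lt' r y (genF r j z)) := by
  by_cases h0 : j = 0
  · subst h0
    have h := D0_lead hr qh k0 u0 k kr ur t z
    have := Submodule.add_mem _ (spn_mono (S' := fun y => y = z ∨ y = genF r 0 z ∨
      lt' r y (genF r 0 z)) (fun y hy => Or.inr (Or.inr hy)) h)
      (Submodule.smul_mem _ ((kap0 k kr ur z : Fˣ) : F) (X_mem (Or.inr (Or.inl rfl))))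
    rw [sub_add_cancel] at this
    rw [Dop, if_pos rfl]; exact this
  · have h := TInv_lt hr qh k0 u0 k kr ur t hj h0 z
    have := Submodule.add_mem _ (spn_mono (S' := fun y => y = z ∨ y = genF r j z ∨
      lt' r y (genF r j z)) (fun y hy => Or.inr (Or.inr hy)) h)
      (Submodule.smul_mem _ ((kap k kr ur j z : Fˣ) : F) (X_mem (Or.inr (Or.inl rfl))))
    rw [sub_add_cancel] at this
    rw [Dop_X _ _ _ _ _ _ _ h0]
    exact Submodule.add_mem _ this (Submodule.smul_mem _ _ (X_mem (Or.inl rfl)))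

lemma D_lead {F : Type*} [Field F] {r : ℕ} (hr : 2 ≤ r) (qh : Fˣ) (k0 u0 : F) (k kr ur : Fˣ)
    (t : Fin r → Fˣ) {j : ℕ} (hj : j ≤ r) {z : E r} (hz : 0 < alphaF r j z) :
    Dop F r qh k0 u0 k kr ur t j (X F r z) -
      ((ksj F r k kr ur j z : Fˣ) : F) • X F r (genF r j z) ∈
      spn F r (fun y => lt' r y (genF r j z)) := by
  by_cases h0 : j = 0
  · subst h0
    rw [Dop, if_pos rfl, ← kap0_ksj hr k kr ur z hz]
    exact D0_lead hr qh k0 u0 k kr ur t z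
  · have hk : ksj F r k kr ur j z = kap k kr ur j z := by
      rw [alphaF, if_neg h0] at hz
      rw [ksj, if_neg h0, kap]
      by_cases hjr : j = r
      · rw [if_pos hjr] at hz
        rw [if_pos hjr, if_pos hjr, etaE_shift hz]
      · rw [if_neg hjr] at hz
        rw [if_neg hjr, if_neg hjr, eta_shift hz]
    rw [hk, Dop_X _ _ _ _ _ _ _ h0, add_sub_right_comm]
    exact Submodule.add_mem _ (TInv_lt hr qh k0 u0 k kr ur t hj h0 z)
      (Submodule.smul_mem _ _ (X_mem (lt_up hr hj hz)))

lemma D_fix {F : Type*} [Field F] {r : ℕ} (hr : 2 ≤ r) (qh : Fˣ) (k0 u0 : F) (k kr ur : Fˣ)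
    (t : Fin r → Fˣ) {j : ℕ} (hj : j ≤ r) {c : E r} (hc : c ∈ CplusCl r) (hz : alphaF r j c = 0) :
    Dop F r qh k0 u0 k kr ur t j (X F r c)
        = (if j = 0 then (ur : F) else if j = r then (kr : F) else (k : F)) • X F r c := by
  have hbot : spn F r (fun y => lt' r y c) ≤ ⊥ :=
    spn_le fun y hy => absurd hy (not_lt_c hc y)
  by_cases h0 : j = 0
  · subst h0
    have h := D0_lead hr qh k0 u0 k kr ur t c
    rw [genF_fix hr hj hz, kap0_c hr k kr ur hc hz] at h
    have h' := (Submodule.mem_bot F).1 (hbot h)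
    rw [Dop, if_pos rfl, if_pos rfl]
    exact sub_eq_zero.1 h'
  · have h := TInv_lt hr qh k0 u0 k kr ur t hj h0 c
    rw [genF_fix hr hj hz] at h
    have h' := sub_eq_zero.1 ((Submodule.mem_bot F).1 (hbot h))
    rw [Dop_X _ _ _ _ _ _ _ h0, h', ← add_smul, if_neg h0]
    congr 1
    rw [alphaF, if_neg h0] at hz
    rw [kap]
    by_cases hjr : j = r
    · rw [if_pos hjr] at hz
      rw [if_pos hjr, if_pos hjr, if_pos hjr, hz, show (0 : ℝ) + 2 = 2 * ((1 : ℤ) : ℝ) by norm_num,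
        etaE_even, show (0 : ℝ) = 2 * ((0 : ℤ) : ℝ) by norm_num, etaO_even]
      simp
    · rw [if_neg hjr] at hz
      rw [if_neg hjr, if_neg hjr, if_neg hjr, hz, show (0 : ℝ) + 1 = ((1 : ℤ) : ℝ) by norm_num,
        eta_int]
      simp

lemma D_word {F : Type*} [Field F] {r : ℕ} (hr : 2 ≤ r) (qh : Fˣ) (k0 u0 : F) (k kr ur : Fˣ)
    (t : Fin r → Fˣ) {c : E r} {l : List ℕ} (hl : OKw r l) (ha : Asc r c l) :
    applyD F r qh k0 u0 k kr ur t l (X F r c) -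
      ((kword F r k kr ur l c : Fˣ) : F) • X F r (wordAct r l c) ∈
      spn F r (fun y => lt' r y (wordAct r l c)) := by
  induction l with
  | nil =>
    rw [kword_nil, wordAct_nil]
    simp [applyD]
  | cons j l ih =>
    have ih := ih hl.tail ha.2
    have hj := hl.head
    have hz := ha.1
    rw [wordAct_cons, kword_cons]
    set z := wordAct r l c
    have e0 : applyD F r qh k0 u0 k kr ur t (j :: l) (X F r c) =
      Dop F r qh k0 u0 k kr ur t j (applyD F r qh k0 u0 k kr ur t l (X F r c)) := rfl
    rw [e0]
    set f := applyD F r qh k0 u0 k kr ur t l (X F r c)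
    set D := Dop F r qh k0 u0 (k : F) (kr : F) (ur : F) t j with hD
    have e : D f - ((ksj F r k kr ur j z * kword F r k kr ur l c : Fˣ) : F) • X F r (genF r j z) =
        D (f - ((kword F r k kr ur l c : Fˣ) : F) • X F r z) +
        ((kword F r k kr ur l c : Fˣ) : F) • (D (X F r z) -
          ((ksj F r k kr ur j z : Fˣ) : F) • X F r (genF r j z)) := by
      rw [map_sub, map_smul, Units.val_mul]; module
    rw [e]
    refine Submodule.add_mem _ ?_ (Submodule.smul_mem _ _ (D_lead hr qh k0 u0 k kr ur t hj hz))
    have hle : spn F r (fun y => lt' r y z) ≤ (spn F r (fun y => lt' r y (genF r j z))).comap D := by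
      apply spn_le
      intro y hy
      rw [Submodule.mem_comap]
      have up := lt_up hr hj hz
      have h1 : lt' r (genF r j y) (genF r j z) := by
        rcases lt_lift hr hj hy with h | h | h
        · exact h
        · rw [h]; exact up
        · exact Relation.TransGen.trans h up
      refine spn_mono ?_ (D_gen hr qh k0 u0 k kr ur t hj y)
      rintro y' (rfl | rfl | h)
      · exact Relation.TransGen.trans hy up
      · exact h1
      · exact Relation.TransGen.trans h h1
    exact hle ih

/-- (1) `D_j(x^{c^𝒪}) = k̃_j x^{c^𝒪}` for `j ∈ J(𝒪)`;
(2) for `w ∈ W^𝒪` with reduced expression `s_{j₁}⋯s_{j_ℓ}`,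
`D_{j₁}(⋯(D_{j_ℓ}(x^{c^𝒪}))⋯) = k_w(c^𝒪)·x^{w c^𝒪} + l.o.t.`, and `k_w(c^𝒪)` does not
depend on the chosen reduced expression. -/
theorem statement19 (F : Type*) [Field F] [CharZero F] (r : ℕ) (hr : 2 ≤ r)
    (qh k0 u0 k kr ur : Fˣ) (O : Set (E r)) (hO : IsOrbit r O)
    (t : Fin r → Fˣ) (ht : t ∈ TOset F r qh O) :
    (∀ j : ℕ, j ≤ r → alphaF r j (cpt r O) = 0 →
      Dop F r qh (k0 : F) (u0 : F) (k : F) (kr : F) (ur : F) t j (X F r (cpt r O))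
        = (if j = 0 then (ur : F) else if j = r then (kr : F) else (k : F)) •
            X F r (cpt r O)) ∧
    (∀ l : List ℕ, (∀ a ∈ l, a ≤ r) →
      l.length = wlen r (fun y => wordAct r l y) →
      (∀ u, IsWJfun r O u →
        wlen r (fun y => wordAct r l y) ≤ wlen r (fun y => wordAct r l (u y))) →
      (applyD F r qh (k0 : F) (u0 : F) (k : F) (kr : F) (ur : F) t l (X F r (cpt r O))
          - ((kword F r k kr ur l (cpt r O) : Fˣ) : F) • X F r (wordAct r l (cpt r O))
        ∈ ltSpan F r (wordAct r l (cpt r O))) ∧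
      (∀ l' : List ℕ, (∀ a ∈ l', a ≤ r) →
        l'.length = wlen r (fun y => wordAct r l' y) →
        (fun y => wordAct r l' y) = (fun y => wordAct r l y) →
        kword F r k kr ur l' (cpt r O) = kword F r k kr ur l (cpt r O))) := by
  have hc := cpt_mem hr hO
  refine ⟨fun j hj hz => D_fix hr qh _ _ k kr ur t hj hc hz, fun l hl hred hmin => ?_⟩
  have ha := asc_of_min hr hc hl hred hmin
  refine ⟨?_, fun l' hl' hred' heq => ?_⟩
  · exact spn_le (N := ltSpan F r (wordAct r l (cpt r O)))
      (fun y hy => Submodule.subset_span ⟨y, qlt_of_lt hr hc hl hy, rfl⟩)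
      (D_word hr qh _ _ k kr ur t hl ha)
  · have he : ∀ y, wordAct r l' y = wordAct r l y := fun y => congrFun heq y
    have ha' : Asc r (cpt r O) l' := asc_of_min hr hc hl' hred' (by
      intro u hu
      simp only [he]
      exact hmin u hu)
    have h1 := kword_pot hr k kr ur hl ha
    have h2 := kword_pot hr k kr ur hl' ha'
    rw [he] at h2
    exact mul_right_cancel (h2.trans h1.symm)

end QP

end
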